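/- arXiv:1302.3822 — 3 statements merged into one kernel-verified Lean document; each statement's English description precedes it below -/
import Mathlib

section
/- Let K be a field of arbitrary characteristic and let A ⊇ B be affine line arrangements in K² such that χ(A,t) = (t − a)(t − c) and χ(B,t) = (t − a)(t − b) with a, b, c ∈ ℤ_{≥0} and a ≤ b ≤ c. If B is free, then A is free. -/
open MvPolynomial

variable {K : Type*} [Field K]

/-- A subset of `K × K` is an affine line: the zero set of a nonzero degree-one equation. -/
def IsAffineLine (L : Set (K × K)) : Prop :=
  ∃ a b c : K, (a, b) ≠ (0, 0) ∧ L = {p : K × K | a * p.1 + b * p.2 + c = 0}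

/-- An affine line arrangement: a finite set of affine lines in `K²`. -/
def IsLineArr (A : Finset (Set (K × K))) : Prop :=
  ∀ L ∈ A, IsAffineLine L

open Classical in
/-- The second Betti number `b₂(A)` of a line arrangement, via Whitney's theorem:
`b₂(A) = ∑ (-1)^{|B|}` over the subsets `B ⊆ A` with `|B| ≥ 2` and `⋂ B ≠ ∅`. -/
noncomputable def b2 (A : Finset (Set (K × K))) : ℤ :=
  ∑ B ∈ A.powerset.filter
      (fun B : Finset (Set (K × K)) => 2 ≤ B.card ∧ (⋂ L ∈ B, (L : Set (K × K))).Nonempty),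
    (-1 : ℤ) ^ B.card

/-- The characteristic polynomial `χ(A,t) = t² − |A|·t + b₂(A)`, evaluated at `t : ℂ`. -/
noncomputable def chi (A : Finset (Set (K × K))) (t : ℂ) : ℂ :=
  t ^ 2 - (A.card : ℂ) * t + (b2 A : ℂ)

/-- `nOn A H = |A ∩ H|`: the number of intersection points, lying on the line `H`, of `H`
with the lines of `A` other than `H`. -/
noncomputable def nOn (A : Finset (Set (K × K))) (H : Set (K × K)) : ℕ :=
  Set.ncard {p : K × K | p ∈ H ∧ ∃ L ∈ A, L ≠ H ∧ p ∈ L}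

/-- The linear form `a·x + b·y + c·z` in `K[x,y,z]`. -/
noncomputable def lin3 (a b c : K) : MvPolynomial (Fin 3) K :=
  C a * X 0 + C b * X 1 + C c * X 2

/-- The action on `f` of the derivation with coefficient vector `θ`. -/
noncomputable def applyDer3 (θ : Fin 3 → MvPolynomial (Fin 3) K)
    (f : MvPolynomial (Fin 3) K) : MvPolynomial (Fin 3) K :=
  ∑ i, θ i * pderiv i f

/-- `θ` belongs to `D(cA)`, the logarithmic derivation module of the cone of `A`:
`θ(α_H) ∈ S·α_H` for every `H ∈ cA`, where `cA` consists of the homogenizations of the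
lines of `A` together with the plane `z = 0`. -/
def InDCone (A : Finset (Set (K × K))) (θ : Fin 3 → MvPolynomial (Fin 3) K) : Prop :=
  (∀ L ∈ A, ∀ a b c : K, (a, b) ≠ (0, 0) →
      L = {p : K × K | a * p.1 + b * p.2 + c = 0} →
      ∃ g, applyDer3 θ (lin3 a b c) = g * lin3 a b c) ∧
  (∃ g, applyDer3 θ (X 2) = g * (X 2 : MvPolynomial (Fin 3) K))

/-- A homogeneous derivation of degree `d` on `K[x,y,z]`. -/
def HomogDer3 (θ : Fin 3 → MvPolynomial (Fin 3) K) (d : ℕ) : Prop :=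
  ∀ i, (θ i).IsHomogeneous d

/-- `A` is free with exponents `exp₀(A) = (d₁, d₂)`: `D(cA)` is a free module with a
homogeneous basis consisting of the Euler derivation `x∂ₓ + y∂_y + z∂_z` and two
derivations of degrees `d₁` and `d₂`. -/
def IsFreeExp (A : Finset (Set (K × K))) (d₁ d₂ : ℕ) : Prop :=
  ∃ θ₁ θ₂ : Fin 3 → MvPolynomial (Fin 3) K,
    InDCone A θ₁ ∧ InDCone A θ₂ ∧ HomogDer3 θ₁ d₁ ∧ HomogDer3 θ₂ d₂ ∧
    ∀ θ : Fin 3 → MvPolynomial (Fin 3) K, InDCone A θ →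
      ∃! cfs : MvPolynomial (Fin 3) K × MvPolynomial (Fin 3) K × MvPolynomial (Fin 3) K,
        θ = fun j => cfs.1 * X j + cfs.2.1 * θ₁ j + cfs.2.2 * θ₂ j

/-- `A` is free (with some exponents). -/
def IsFree (A : Finset (Set (K × K))) : Prop := ∃ d₁ d₂ : ℕ, IsFreeExp A d₁ d₂

/-- `A` is free with (integer-valued) exponents `exp₀(A) = (d₁, d₂)`. -/
def IsFreeExpZ (A : Finset (Set (K × K))) (d₁ d₂ : ℤ) : Prop :=
  ∃ e₁ e₂ : ℕ, (e₁ : ℤ) = d₁ ∧ (e₂ : ℤ) = d₂ ∧ IsFreeExp A e₁ e₂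


namespace LineArr

/-- The linear form with coefficient vector `v`. -/
noncomputable def linForm (v : Fin 3 → K) : MvPolynomial (Fin 3) K := ∑ i, C (v i) * X i

/-- The value of the derivation with coefficients `θ` on the linear form `linForm v`. -/
noncomputable def derVal (θ : Fin 3 → MvPolynomial (Fin 3) K) (v : Fin 3 → K) :
    MvPolynomial (Fin 3) K := ∑ i, C (v i) * θ i

/-- Restriction to the plane `linForm h = 0`, realized as a substitution along the
direction `w` (for `h ⬝ᵥ w = 1`). -/
noncomputable def restr (w h : Fin 3 → K) :
    MvPolynomial (Fin 3) K →ₐ[K] MvPolynomial (Fin 3) K :=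
  aeval fun i => X i - C (w i) * linForm h

/-- Membership in the logarithmic derivation module of a central arrangement given by a finite
set of normal vectors. -/
def InD (V : Finset (Fin 3 → K)) (θ : Fin 3 → MvPolynomial (Fin 3) K) : Prop :=
  ∀ v ∈ V, linForm v ∣ derVal θ v

lemma linForm_add (v v' : Fin 3 → K) : linForm (v + v') = linForm v + linForm v' := by
  simp [linForm, add_mul, Finset.sum_add_distrib]

lemma linForm_smul (c : K) (v : Fin 3 → K) : linForm (c • v) = C c * linForm v := by
  simp [linForm, Finset.mul_sum, mul_assoc]

lemma derVal_comb (θ : Fin 3 → MvPolynomial (Fin 3) K) (s t : K) (v v' : Fin 3 → K) :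
    derVal θ (s • v + t • v') = C s * derVal θ v + C t * derVal θ v' := by
  simp [derVal, Fin.sum_univ_three]; ring

lemma derVal_add (θ θ' : Fin 3 → MvPolynomial (Fin 3) K) (v : Fin 3 → K) :
    derVal (θ + θ') v = derVal θ v + derVal θ' v := by
  simp [derVal, mul_add, Finset.sum_add_distrib]

lemma derVal_mul (f : MvPolynomial (Fin 3) K) (θ : Fin 3 → MvPolynomial (Fin 3) K)
    (v : Fin 3 → K) : derVal (f • θ) v = f * derVal θ v := by
  simp [derVal, Fin.sum_univ_three]; ring

lemma derVal_mul_const (f : MvPolynomial (Fin 3) K) (u v : Fin 3 → K) :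
    derVal (fun i => f * C (u i)) v = f * C (v ⬝ᵥ u) := by
  simp [derVal, dotProduct, Fin.sum_univ_three]; ring

lemma derVal_comb3 (p q r : MvPolynomial (Fin 3) K) (θ₁ θ₂ : Fin 3 → MvPolynomial (Fin 3) K)
    (v : Fin 3 → K) :
    derVal (fun j => p * X j + q * θ₁ j + r * θ₂ j) v =
      p * linForm v + q * derVal θ₁ v + r * derVal θ₂ v := by
  simp [derVal, linForm, Fin.sum_univ_three]; ring

lemma linForm_isHomogeneous (v : Fin 3 → K) : (linForm v).IsHomogeneous 1 :=
  IsHomogeneous.sum _ _ _ fun _ _ => isHomogeneous_C_mul_X _ _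

lemma derVal_isHomogeneous {θ : Fin 3 → MvPolynomial (Fin 3) K} {d : ℕ} (hθ : HomogDer3 θ d)
    (v : Fin 3 → K) : (derVal θ v).IsHomogeneous d :=
  IsHomogeneous.sum _ _ _ fun i _ => (hθ i).C_mul _

lemma aeval_linForm (g : Fin 3 → MvPolynomial (Fin 3) K) (v : Fin 3 → K) :
    aeval g (linForm v) = derVal g v := by
  simp [linForm, derVal, algebraMap_eq]

lemma eval_linForm (z v : Fin 3 → K) : eval z (linForm v) = v ⬝ᵥ z := by
  simp [linForm, dotProduct]

lemma linForm_injective : Function.Injective (linForm : (Fin 3 → K) → _) := by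
  intro v v' h
  ext i
  have := congrArg (eval (Pi.single i 1)) h
  simpa [eval_linForm] using this

lemma linForm_zero : linForm (0 : Fin 3 → K) = 0 := by simp [linForm]

lemma linForm_ne_zero {v : Fin 3 → K} (hv : v ≠ 0) : linForm v ≠ 0 := by
  rw [← linForm_zero]; exact fun h => hv (linForm_injective h)

lemma sub_aeval_mem (I : Ideal (MvPolynomial (Fin 3) K)) (g : Fin 3 → MvPolynomial (Fin 3) K)
    (hg : ∀ i, X i - g i ∈ I) (f : MvPolynomial (Fin 3) K) : f - aeval g f ∈ I := by
  rw [← Ideal.Quotient.eq]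
  have : (Ideal.Quotient.mkₐ K I) = (Ideal.Quotient.mkₐ K I).comp (aeval g) := by
    ext i
    simpa using Ideal.Quotient.eq.2 (hg i)
  exact DFunLike.congr_fun this f

lemma restr_linForm (w h v : Fin 3 → K) :
    restr w h (linForm v) = linForm (v - (v ⬝ᵥ w) • h) := by
  rw [restr, aeval_linForm]
  simp [derVal, linForm, dotProduct, Fin.sum_univ_three]; ring

lemma restr_self {w h : Fin 3 → K} (hw : h ⬝ᵥ w = 1) : restr w h (linForm h) = 0 := by
  rw [restr_linForm, hw]; simp [linForm_zero]

lemma dvd_sub_restr (w h : Fin 3 → K) (f : MvPolynomial (Fin 3) K) :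
    linForm h ∣ f - restr w h f := by
  rw [← Ideal.mem_span_singleton]
  refine sub_aeval_mem _ _ (fun i => ?_) f
  rw [Ideal.mem_span_singleton]
  exact ⟨C (w i), by ring⟩

lemma restr_eq_zero_iff {w h : Fin 3 → K} (hw : h ⬝ᵥ w = 1) (f : MvPolynomial (Fin 3) K) :
    restr w h f = 0 ↔ linForm h ∣ f := by
  constructor
  · intro hf
    simpa [hf] using dvd_sub_restr w h f
  · rintro ⟨g, rfl⟩
    simp [restr_self hw]

lemma restr_restr {w h : Fin 3 → K} (hw : h ⬝ᵥ w = 1) (f : MvPolynomial (Fin 3) K) :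
    restr w h (restr w h f) = restr w h f := by
  have := (restr_eq_zero_iff hw _).2 (dvd_sub_restr w h f)
  rw [map_sub, sub_eq_zero] at this
  exact this.symm

lemma restr_isHomogeneous (w h : Fin 3 → K) {f : MvPolynomial (Fin 3) K} {d : ℕ}
    (hf : f.IsHomogeneous d) : (restr w h f).IsHomogeneous d := by
  have := hf.aeval (fun i => X i - C (w i) * linForm h) (n := 1)
    fun i => (isHomogeneous_X _ _).sub ((linForm_isHomogeneous h).C_mul _)
  simpa [restr] using this

lemma exists_dotProduct_eq_one {h : Fin 3 → K} (hh : h ≠ 0) : ∃ w : Fin 3 → K, h ⬝ᵥ w = 1 := by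
  obtain ⟨i, hi⟩ := Function.ne_iff.1 hh
  exact ⟨Pi.single i (h i)⁻¹, by simp [dotProduct_single, mul_inv_cancel₀ hi]⟩

lemma linForm_dvd_linForm {v v' : Fin 3 → K} (hv : v ≠ 0) (h : linForm v ∣ linForm v') :
    ∃ c : K, v' = c • v := by
  obtain ⟨w, hw⟩ := exists_dotProduct_eq_one hv
  have := (restr_eq_zero_iff hw _).2 h
  rw [restr_linForm, ← linForm_zero] at this
  exact ⟨_, sub_eq_zero.1 (linForm_injective this)⟩

lemma linForm_prime {v : Fin 3 → K} (hv : v ≠ 0) : Prime (linForm v) := by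
  obtain ⟨w, hw⟩ := exists_dotProduct_eq_one hv
  refine ⟨linForm_ne_zero hv, fun hu => ?_, fun f g hfg => ?_⟩
  · have := hu.map (restr w v)
    rw [restr_self hw] at this
    exact not_isUnit_zero this
  · rw [← restr_eq_zero_iff hw] at hfg ⊢
    rw [← restr_eq_zero_iff hw]
    simpa using hfg

lemma linForm_isRelPrime {v v' : Fin 3 → K} (hv : v ≠ 0) (h : ∀ c : K, v' ≠ c • v) :
    IsRelPrime (linForm v) (linForm v') :=
  (linForm_prime hv).irreducible.isRelPrime_iff_not_dvd.2 fun hd => by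
    obtain ⟨c, hc⟩ := linForm_dvd_linForm hv hd
    exact h c hc

/-- The set `R ⊆ V` contains exactly one plane through each of the lines in which the planes of
`V` meet the plane `h`. -/
structure IsTransversal (V R : Finset (Fin 3 → K)) (h : Fin 3 → K) : Prop where
  subset : R ⊆ V
  exists_rep : ∀ v ∈ V, ∃ r ∈ R, ∃ s t : K, v = s • r + t • h
  indep : ∀ r ∈ R, ∀ r' ∈ R, r ≠ r' → ∀ s t : K, r ≠ s • r' + t • h

/-- The vectors of `V` are normal vectors of distinct planes. -/
def IsReduced (V : Finset (Fin 3 → K)) : Prop :=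
  (∀ v ∈ V, v ≠ 0) ∧ ∀ v ∈ V, ∀ v' ∈ V, v ≠ v' → ∀ c : K, v ≠ c • v'

lemma IsReduced.mono {V W : Finset (Fin 3 → K)} (hW : IsReduced W) (h : V ⊆ W) : IsReduced V :=
  ⟨fun v hv => hW.1 v (h hv), fun v hv v' hv' => hW.2 v (h hv) v' (h hv')⟩

open Classical in
lemma IsReduced.of_insert {V : Finset (Fin 3 → K)} {h : Fin 3 → K} (hV : IsReduced (insert h V))
    (hh : h ∉ V) : IsReduced V ∧ h ≠ 0 ∧ ∀ v ∈ V, ∀ c : K, v ≠ c • h :=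
  ⟨hV.mono (Finset.subset_insert _ _), hV.1 h (Finset.mem_insert_self _ _), fun v hv =>
    hV.2 v (Finset.mem_insert_of_mem hv) h (Finset.mem_insert_self _ _)
      fun e => hh (e ▸ hv)⟩

lemma restr_linForm_ne_zero (w : Fin 3 → K) {h v : Fin 3 → K} (hv : ∀ c : K, v ≠ c • h) :
    restr w h (linForm v) ≠ 0 := by
  rw [restr_linForm]
  exact linForm_ne_zero fun h0 => hv _ (sub_eq_zero.1 h0)

lemma restr_linForm_isRelPrime (w : Fin 3 → K) {h v v' : Fin 3 → K} (hv : ∀ c : K, v ≠ c • h)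
    (hvv : ∀ s t : K, v' ≠ s • v + t • h) :
    IsRelPrime (restr w h (linForm v)) (restr w h (linForm v')) := by
  rw [restr_linForm, restr_linForm]
  refine linForm_isRelPrime (fun h0 => hv _ (sub_eq_zero.1 h0)) fun c hc => ?_
  refine hvv c (v' ⬝ᵥ w - c * (v ⬝ᵥ w)) ?_
  rw [sub_eq_iff_eq_add] at hc
  nth_rewrite 1 [hc]
  module

open Classical in
lemma prod_dvd_restr_derVal {V R : Finset (Fin 3 → K)} {w h : Fin 3 → K}
    (hw : h ⬝ᵥ w = 1) (hV : IsReduced V) (hh : ∀ v ∈ V, ∀ c : K, v ≠ c • h)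
    (hR : IsTransversal V R h) {θ : Fin 3 → MvPolynomial (Fin 3) K} (hθ : InD V θ) :
    ∏ v ∈ V \ R, restr w h (linForm v) ∣ restr w h (derVal θ h) := by
  choose! ρ hρ s t hst using hR.exists_rep
  rw [← Finset.prod_fiberwise_of_maps_to (t := R) (g := ρ)
    (fun v hv => hρ v (Finset.mem_sdiff.1 hv).1)]
  refine Finset.prod_dvd_of_isRelPrime ?_ fun r hr => ?_
  · intro r hr r' hr' hrr
    refine IsRelPrime.prod_left fun v hv => IsRelPrime.prod_right fun v' hv' => ?_
    simp only [Finset.mem_filter, Finset.mem_sdiff] at hv hv'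
    obtain ⟨⟨hvV, hvR⟩, rfl⟩ := hv
    obtain ⟨⟨hvV', hvR'⟩, rfl⟩ := hv'
    refine restr_linForm_isRelPrime w (hh v hvV) fun a b hab => ?_
    have hs' : s v' ≠ 0 := fun h0 => hh v' hvV' (t v') (by
      conv_lhs => rw [hst v' hvV', h0]
      simp)
    refine hR.indep _ hr' _ hr (Ne.symm hrr) ((s v')⁻¹ * a * s v)
      ((s v')⁻¹ * (a * t v + b - t v')) ?_
    have h1 : s v' • ρ v' = (a * s v) • ρ v + (a * t v + b - t v') • h := by
      have h3 : s v' • ρ v' = a • (s v • ρ v + t v • h) + b • h - t v' • h := by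
        rw [← hst v hvV, ← hab]
        exact eq_sub_of_add_eq (hst v' hvV').symm
      rw [h3]; module
    calc ρ v' = (s v')⁻¹ • s v' • ρ v' := by rw [smul_smul, inv_mul_cancel₀ hs', one_smul]
      _ = _ := by rw [h1]; module
  · obtain ⟨g, hg⟩ := hθ r (hR.subset hr)
    have key : ∏ v ∈ V \ R with ρ v = r, linForm v ∣ derVal θ h - g * linForm h := by
      refine Finset.prod_dvd_of_isRelPrime ?_ fun v hv => ?_
      · intro v hv v' hv' hne
        simp only [Finset.coe_filter, Finset.mem_sdiff, Set.mem_ofPred_eq] at hv hv'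
        exact linForm_isRelPrime (hV.1 v hv.1.1) (hV.2 v' hv'.1.1 v hv.1.1 hne.symm)
      · simp only [Finset.mem_filter, Finset.mem_sdiff] at hv
        obtain ⟨⟨hvV, hvR⟩, rfl⟩ := hv
        have ht : t v ≠ 0 := fun h0 => hV.2 v hvV (ρ v) (hR.subset hr)
          (fun e => hvR (by rw [e]; exact hr)) (s v) (by
            conv_lhs => rw [hst v hvV, h0]
            simp)
        have e1 : derVal θ v - g * linForm v = C (t v) * (derVal θ h - g * linForm h) := by
          have e2 : derVal θ v = C (s v) * derVal θ (ρ v) + C (t v) * derVal θ h := by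
            conv_lhs => rw [hst v hvV]
            exact derVal_comb _ _ _ _ _
          have e3 : linForm v = C (s v) * linForm (ρ v) + C (t v) * linForm h := by
            conv_lhs => rw [hst v hvV]
            exact derVal_comb X _ _ _ _
          rw [e2, e3, hg]; ring
        have e4 : linForm v ∣ C (t v) * (derVal θ h - g * linForm h) := by
          rw [← e1]; exact dvd_sub (hθ v hvV) (dvd_mul_left _ _)
        exact ((ht.isUnit.map C).dvd_mul_left).1 e4
    have := map_dvd (restr w h) key
    simpa [restr_self hw, map_prod] using this

/-- `θ₁, θ₂` complete the Euler derivation to a homogeneous basis of the logarithmic derivations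
of `V`. -/
structure IsDerBasis (V : Finset (Fin 3 → K)) (d₁ d₂ : ℕ)
    (θ₁ θ₂ : Fin 3 → MvPolynomial (Fin 3) K) : Prop where
  mem₁ : InD V θ₁
  mem₂ : InD V θ₂
  homog₁ : HomogDer3 θ₁ d₁
  homog₂ : HomogDer3 θ₂ d₂
  spans : ∀ θ, InD V θ → ∃ p q r : MvPolynomial (Fin 3) K,
    θ = fun j => p * X j + q * θ₁ j + r * θ₂ j
  indep : ∀ p q r : MvPolynomial (Fin 3) K, (∀ j, p * X j + q * θ₁ j + r * θ₂ j = 0) →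
    p = 0 ∧ q = 0 ∧ r = 0

lemma IsDerBasis.symm {V : Finset (Fin 3 → K)} {d₁ d₂ : ℕ}
    {θ₁ θ₂ : Fin 3 → MvPolynomial (Fin 3) K} (hb : IsDerBasis V d₁ d₂ θ₁ θ₂) :
    IsDerBasis V d₂ d₁ θ₂ θ₁ where
  mem₁ := hb.mem₂
  mem₂ := hb.mem₁
  homog₁ := hb.homog₂
  homog₂ := hb.homog₁
  spans θ hθ := by
    obtain ⟨p, q, r, h⟩ := hb.spans θ hθ
    exact ⟨p, r, q, by rw [h]; ext1 j; ring⟩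
  indep p q r h := by
    obtain ⟨h1, h2, h3⟩ := hb.indep p r q fun j => by rw [← h j]; ring
    exact ⟨h1, h3, h2⟩

lemma IsDerBasis.shear {V : Finset (Fin 3 → K)} {d₁ d₂ : ℕ}
    {θ₁ θ₂ : Fin 3 → MvPolynomial (Fin 3) K} (hb : IsDerBasis V d₁ d₂ θ₁ θ₂) (c : K)
    (hc : c = 0 ∨ d₁ = d₂) :
    IsDerBasis V d₁ d₂ (fun j => θ₁ j - C c * θ₂ j) θ₂ where
  mem₁ v hv := by
    have : derVal (fun j => θ₁ j - C c * θ₂ j) v = derVal θ₁ v - C c * derVal θ₂ v := by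
      simp [derVal, Fin.sum_univ_three]; ring
    rw [this]
    exact dvd_sub (hb.mem₁ v hv) ((hb.mem₂ v hv).mul_left _)
  mem₂ := hb.mem₂
  homog₁ j := by
    rcases hc with rfl | rfl
    · simpa using hb.homog₁ j
    · exact (hb.homog₁ j).sub ((hb.homog₂ j).C_mul _)
  homog₂ := hb.homog₂
  spans θ hθ := by
    obtain ⟨p, q, r, h⟩ := hb.spans θ hθ
    exact ⟨p, q, r + C c * q, by rw [h]; ext1 j; ring⟩
  indep p q r h := by
    obtain ⟨h1, h2, h3⟩ := hb.indep p q (r - C c * q) fun j => by rw [← h j]; ring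
    subst h2
    exact ⟨h1, rfl, by simpa using h3⟩

lemma inD_prod (V : Finset (Fin 3 → K)) (u : Fin 3 → K) :
    InD V fun i => (∏ v ∈ V, linForm v) * C (u i) := by
  intro v hv
  rw [derVal_mul_const]
  exact (Finset.dvd_prod_of_mem _ hv).mul_right _

lemma IsDerBasis.restr_ne_zero {V : Finset (Fin 3 → K)} {d₁ d₂ : ℕ}
    {θ₁ θ₂ : Fin 3 → MvPolynomial (Fin 3) K} (hb : IsDerBasis V d₁ d₂ θ₁ θ₂) {w h : Fin 3 → K}
    (hw : h ⬝ᵥ w = 1) (hh : ∀ v ∈ V, ∀ c : K, v ≠ c • h)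
    (h1 : restr w h (derVal θ₁ h) = 0) (h2 : restr w h (derVal θ₂ h) = 0) : False := by
  obtain ⟨p, q, r, e⟩ := hb.spans _ (inD_prod V w)
  have e' := congrArg (fun θ => restr w h (derVal θ h)) e
  simp only [derVal_comb3, derVal_mul_const, hw, map_add, map_mul, h1, h2, restr_self hw,
    mul_zero, add_zero, map_one, mul_one, map_prod] at e'
  exact (Finset.prod_ne_zero_iff.2 fun v hv => restr_linForm_ne_zero w (hh v hv)) e'

lemma eq_C_mul_of_dvd {β f : MvPolynomial (Fin 3) K} {d e : ℕ} (hβ : β.IsHomogeneous e)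
    (hβ0 : β ≠ 0) (hf : f.IsHomogeneous d) (hd : d ≤ e) (hdvd : β ∣ f) :
    (d < e → f = 0) ∧ ∃ c : K, f = C c * β := by
  by_cases hf0 : f = 0
  · exact ⟨fun _ => hf0, 0, by simp [hf0]⟩
  · obtain ⟨g, rfl⟩ := hdvd
    have hg0 : g ≠ 0 := right_ne_zero_of_mul hf0
    have := totalDegree_mul_of_isDomain hβ0 hg0
    rw [hf.totalDegree hf0, hβ.totalDegree hβ0] at this
    refine ⟨fun h => by omega, coeff 0 g, ?_⟩
    rw [← (totalDegree_eq_zero_iff_eq_C).1 (by omega : g.totalDegree = 0), mul_comm]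

open Classical in
lemma restr_prod_isHomogeneous (w h : Fin 3 → K) (V : Finset (Fin 3 → K)) :
    (∏ v ∈ V, restr w h (linForm v)).IsHomogeneous V.card := by
  have := IsHomogeneous.prod V (fun v => restr w h (linForm v)) (fun _ => 1)
    fun v _ => restr_isHomogeneous w h (linForm_isHomogeneous v)
  simpa using this

open Classical in
lemma IsDerBasis.card_sdiff_le {V R : Finset (Fin 3 → K)} {a b : ℕ}
    {θ₁ θ₂ : Fin 3 → MvPolynomial (Fin 3) K} (hb : IsDerBasis V a b θ₁ θ₂) (hab : a ≤ b)
    {h : Fin 3 → K} (h0 : h ≠ 0) (hV : IsReduced V) (hh : ∀ v ∈ V, ∀ c : K, v ≠ c • h)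
    (hR : IsTransversal V R h) : (V \ R).card ≤ b := by
  by_contra! hlt
  obtain ⟨w, hw⟩ := exists_dotProduct_eq_one h0
  have hβ := restr_prod_isHomogeneous w h (V \ R)
  have hβ0 : ∏ v ∈ V \ R, restr w h (linForm v) ≠ 0 := Finset.prod_ne_zero_iff.2 fun v hv =>
    restr_linForm_ne_zero w (hh v (Finset.mem_sdiff.1 hv).1)
  refine hb.restr_ne_zero hw hh ?_ ?_
  · exact (eq_C_mul_of_dvd hβ hβ0 (restr_isHomogeneous w h (derVal_isHomogeneous hb.homog₁ h))
      (by omega) (prod_dvd_restr_derVal hw hV hh hR hb.mem₁)).1 (by omega)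
  · exact (eq_C_mul_of_dvd hβ hβ0 (restr_isHomogeneous w h (derVal_isHomogeneous hb.homog₂ h))
      (by omega) (prod_dvd_restr_derVal hw hV hh hR hb.mem₂)).1 (by omega)

open Classical in
lemma IsDerBasis.insert_of_restr {V : Finset (Fin 3 → K)} {d₁ d₂ : ℕ}
    {θ₁ θ₂ : Fin 3 → MvPolynomial (Fin 3) K} (hb : IsDerBasis V d₁ d₂ θ₁ θ₂) {w h : Fin 3 → K}
    (h0 : h ≠ 0) (hw : h ⬝ᵥ w = 1) (h1 : restr w h (derVal θ₁ h) = 0)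
    (h2 : restr w h (derVal θ₂ h) ≠ 0) :
    IsDerBasis (insert h V) d₁ (d₂ + 1) θ₁ (fun j => linForm h * θ₂ j) where
  mem₁ v hv := by
    rcases Finset.mem_insert.1 hv with rfl | hv
    · exact (restr_eq_zero_iff hw _).1 h1
    · exact hb.mem₁ v hv
  mem₂ v hv := by
    have e : derVal (fun j => linForm h * θ₂ j) v = linForm h * derVal θ₂ v :=
      derVal_mul (linForm h) θ₂ v
    rw [e]
    rcases Finset.mem_insert.1 hv with rfl | hv
    · exact dvd_mul_right _ _
    · exact (hb.mem₂ v hv).mul_left _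
  homog₁ := hb.homog₁
  homog₂ j := by
    rw [add_comm]
    exact (linForm_isHomogeneous h).mul (hb.homog₂ j)
  spans θ hθ := by
    obtain ⟨p, q, r, rfl⟩ := hb.spans θ fun v hv => hθ v (Finset.mem_insert_of_mem hv)
    have e := (restr_eq_zero_iff hw _).2 (hθ h (Finset.mem_insert_self _ _))
    rw [derVal_comb3] at e
    simp only [map_add, map_mul, restr_self hw, h1, mul_zero, zero_add, mul_eq_zero, h2,
      or_false] at e
    obtain ⟨r', rfl⟩ := (restr_eq_zero_iff hw _).1 e
    exact ⟨p, q, r', by ext1 j; ring⟩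
  indep p q r h := by
    obtain ⟨e1, e2, e3⟩ := hb.indep p q (r * linForm _) fun j => by rw [← h j]; ring
    exact ⟨e1, e2, (mul_eq_zero.1 e3).resolve_right (linForm_ne_zero h0)⟩

open Classical in
lemma IsDerBasis.exists_insert {V R : Finset (Fin 3 → K)} {a b : ℕ}
    {θ₁ θ₂ : Fin 3 → MvPolynomial (Fin 3) K} (hb : IsDerBasis V a b θ₁ θ₂) (hab : a ≤ b)
    {h : Fin 3 → K} (h0 : h ≠ 0) (hV : IsReduced V) (hh : ∀ v ∈ V, ∀ c : K, v ≠ c • h)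
    (hR : IsTransversal V R h) (hcard : (V \ R).card = b) :
    ∃ θ₁' θ₂', IsDerBasis (insert h V) a (b + 1) θ₁' θ₂' := by
  obtain ⟨w, hw⟩ := exists_dotProduct_eq_one h0
  have hβ := restr_prod_isHomogeneous w h (V \ R)
  have hβ0 : ∏ v ∈ V \ R, restr w h (linForm v) ≠ 0 := Finset.prod_ne_zero_iff.2 fun v hv =>
    restr_linForm_ne_zero w (hh v (Finset.mem_sdiff.1 hv).1)
  obtain ⟨hz, c₁, hc₁⟩ := eq_C_mul_of_dvd hβ hβ0
    (restr_isHomogeneous w h (derVal_isHomogeneous hb.homog₁ h))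
    (by omega) (prod_dvd_restr_derVal hw hV hh hR hb.mem₁)
  obtain ⟨-, c₂, hc₂⟩ := eq_C_mul_of_dvd hβ hβ0
    (restr_isHomogeneous w h (derVal_isHomogeneous hb.homog₂ h))
    (by omega) (prod_dvd_restr_derVal hw hV hh hR hb.mem₂)
  by_cases h2 : c₂ = 0
  · rw [h2, C_0, zero_mul] at hc₂
    have hne : restr w h (derVal θ₁ h) ≠ 0 := fun h1 => hb.restr_ne_zero hw hh h1 hc₂
    have hab' : a = b := by
      by_contra hne'
      exact hne (hz (by omega))
    subst hab'
    exact ⟨_, _, hb.symm.insert_of_restr h0 hw hc₂ hne⟩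
  · have hc : c₁ / c₂ = 0 ∨ a = b := by
      by_cases hab' : a = b
      · exact Or.inr hab'
      · left
        have := hz (by omega)
        rw [hc₁] at this
        have := (mul_eq_zero.1 this).resolve_right hβ0
        rw [C_eq_zero.1 this, zero_div]
    refine ⟨_, _, (hb.shear _ hc).insert_of_restr h0 hw ?_ ?_⟩
    · have : derVal (fun j => θ₁ j - C (c₁ / c₂) * θ₂ j) h =
          derVal θ₁ h - C (c₁ / c₂) * derVal θ₂ h := by
        simp [derVal, Fin.sum_univ_three]; ring
      rw [this, map_sub, map_mul, hc₁, hc₂, ← mul_assoc]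
      have e : restr w h (C (c₁ / c₂)) = C (c₁ / c₂) := (restr w h).commutes _
      rw [e, ← C_mul, div_mul_cancel₀ _ h2, sub_self]
    · rw [hc₂]
      exact mul_ne_zero (C_ne_zero.2 h2) hβ0

lemma homogeneousComponent_mul_add {f g : MvPolynomial (Fin 3) K} {e : ℕ}
    (hg : g.IsHomogeneous e) (m : ℕ) :
    homogeneousComponent (m + e) (f * g) = homogeneousComponent m f * g := by
  induction f using MvPolynomial.induction_on' with
  | monomial d c =>
    have hd : (monomial d c : MvPolynomial (Fin 3) K).IsHomogeneous d.degree :=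
      isHomogeneous_monomial c rfl
    rw [homogeneousComponent_of_mem hd, homogeneousComponent_of_mem (hd.mul hg)]
    simp only [add_left_inj, ite_mul, zero_mul]
  | add p q hp hq => simp [map_add, add_mul, hp, hq]

lemma isHomogeneous_of_mul {f g : MvPolynomial (Fin 3) K} {e k : ℕ} (hg : g.IsHomogeneous e)
    (hg0 : g ≠ 0) (hfg : (f * g).IsHomogeneous (k + e)) : f.IsHomogeneous k := by
  have h1 := homogeneousComponent_mul_add (f := f) hg k
  rw [homogeneousComponent_eq_self hfg] at h1
  rw [mul_right_cancel₀ hg0 h1]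
  exact homogeneousComponent_isHomogeneous _ _

lemma aeval_C_mul_of_isHomogeneous {f l : MvPolynomial (Fin 3) K} {j : ℕ}
    (hf : f.IsHomogeneous j) (z : Fin 3 → K) :
    aeval (fun i => C (z i) * l) f = l ^ j * C (eval z f) := by
  rw [aeval_def, eval₂_eq', eval_eq', map_sum, Finset.mul_sum]
  refine Finset.sum_congr rfl fun d hd => ?_
  have hdeg : ∑ i, d i = j := by
    rw [hf.degree_eq_sum_deg_support hd, ← Finsupp.degree_apply, Finsupp.degree_eq_sum]
  simp only [mul_pow, Finset.prod_mul_distrib, Finset.prod_pow_eq_pow_sum, hdeg, map_mul,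
    map_prod, map_pow, algebraMap_eq]
  ring

lemma linearIndependent_pair {h r : Fin 3 → K} (hh : h ≠ 0) (hr : ∀ c : K, r ≠ c • h) :
    LinearIndependent K ![r, h] := by
  rw [LinearIndependent.pair_iff]
  intro s t hst
  have hs : s = 0 := by
    by_contra hs
    apply hr (-(s⁻¹ * t))
    calc r = s⁻¹ • (s • r) := by rw [smul_smul, inv_mul_cancel₀ hs, one_smul]
      _ = _ := by rw [eq_neg_of_add_eq_zero_left hst]; module
  subst hs
  refine ⟨rfl, ?_⟩
  simpa [hh] using hst

/-- The planes containing a common line of two independent planes form the pencil they span. -/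
lemma exists_eq_comb_of_dotProduct_eq_zero {h r z : Fin 3 → K} (hh : h ≠ 0)
    (hr : ∀ c : K, r ≠ c • h) (hz : z ≠ 0) (hhz : h ⬝ᵥ z = 0) (hrz : r ⬝ᵥ z = 0)
    {v : Fin 3 → K} (hv : v ⬝ᵥ z = 0) : ∃ s t : K, v = s • r + t • h := by
  have hrank : Module.finrank K (Submodule.span K (Set.range ![r, h])) = 2 := by
    simpa using finrank_span_eq_card (linearIndependent_pair hh hr)
  let f : Module.Dual K (Fin 3 → K) :=
    { toFun := fun v => v ⬝ᵥ z
      map_add' := fun _ _ => add_dotProduct _ _ _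
      map_smul' := fun _ _ => smul_dotProduct _ _ _ }
  have hf0 : f ≠ 0 := by
    intro e
    obtain ⟨l, hl⟩ := exists_dotProduct_eq_one hz
    rw [dotProduct_comm] at hl
    exact one_ne_zero (hl.symm.trans (LinearMap.congr_fun e l))
  have hker : Submodule.span K (Set.range ![r, h]) = LinearMap.ker f := by
    refine Submodule.eq_of_le_of_finrank_eq ?_ ?_
    · rw [Submodule.span_le]
      rintro _ ⟨i, rfl⟩
      fin_cases i
      · exact hrz
      · exact hhz
    · have := Module.Dual.finrank_ker_add_one_of_ne_zero hf0
      simp only [Module.finrank_fin_fun] at this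
      omega
  have : v ∈ Submodule.span K (Set.range ![r, h]) := by rw [hker]; exact hv
  rw [Matrix.range_cons, Matrix.range_cons, Matrix.range_empty, Set.union_empty,
    Set.singleton_union, Submodule.mem_span_pair] at this
  obtain ⟨s, t, e⟩ := this
  exact ⟨s, t, e.symm⟩

lemma exists_common_zero {h r : Fin 3 → K} (hh : h ≠ 0) (hr : ∀ c : K, r ≠ c • h) :
    ∃ z : Fin 3 → K, z ≠ 0 ∧ h ⬝ᵥ z = 0 ∧ r ⬝ᵥ z = 0 :=
  ⟨crossProduct r h, crossProduct_ne_zero_iff_linearIndependent.2 (linearIndependent_pair hh hr),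
    dot_cross_self _ _, dot_self_cross _ _⟩

lemma linForm_comb (s t : K) (v v' : Fin 3 → K) :
    linForm (s • v + t • v') = C s * linForm v + C t * linForm v' := by
  rw [linForm_add, linForm_smul, linForm_smul]

/-- A form vanishing at the common zero of two independent planes lies in the ideal they
generate. -/
lemma mem_span_pair_of_eval_eq_zero {h r z : Fin 3 → K} (hh : h ≠ 0)
    (hr : ∀ c : K, r ≠ c • h) (hz : z ≠ 0) (hhz : h ⬝ᵥ z = 0) (hrz : r ⬝ᵥ z = 0)
    {f : MvPolynomial (Fin 3) K} {j : ℕ} (hf : f.IsHomogeneous j) (hfz : eval z f = 0) :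
    f ∈ Ideal.span {linForm r, linForm h} := by
  obtain ⟨l, hl⟩ := exists_dotProduct_eq_one hz
  rw [dotProduct_comm] at hl
  have key := sub_aeval_mem (Ideal.span {linForm r, linForm h})
    (fun i => C (z i) * linForm l) (fun i => ?_) f
  · rw [aeval_C_mul_of_isHomogeneous hf, hfz] at key
    simpa using key
  · obtain ⟨s, t, e⟩ := exists_eq_comb_of_dotProduct_eq_zero hh hr hz hhz hrz
      (v := Pi.single i 1 - z i • l) (by
      rw [sub_dotProduct, smul_dotProduct, hl]; simp)
    have e1 : (X i - C (z i) * linForm l : MvPolynomial (Fin 3) K) =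
        linForm (s • r + t • h) := by
      rw [← e, sub_eq_add_neg, sub_eq_add_neg, linForm_add, ← neg_smul, linForm_smul]
      have : linForm (Pi.single i 1 : Fin 3 → K) = X i := by
        simp [linForm, Pi.single_apply, apply_ite C, ite_mul]
      rw [this]; simp
    rw [e1, linForm_comb, Ideal.mem_span_pair]
    exact ⟨_, _, rfl⟩

open Classical in
/-- Interpolation on a plane: forms of degree at least `R.card - 1` are combinations of the
products of all but one of the lines cut out by `R`. -/
lemma exists_restr_eq_sum {w h : Fin 3 → K} (hw : h ⬝ᵥ w = 1) (h0 : h ≠ 0)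
    {R : Finset (Fin 3 → K)} (hR : R.Nonempty) :
    (∀ r ∈ R, ∀ c : K, r ≠ c • h) →
    (∀ r ∈ R, ∀ r' ∈ R, r ≠ r' → ∀ s t : K, r ≠ s • r' + t • h) →
    ∀ (i : ℕ) (f : MvPolynomial (Fin 3) K), f.IsHomogeneous (i + (R.card - 1)) →
    ∃ g : (Fin 3 → K) → MvPolynomial (Fin 3) K, (∀ r, (g r).IsHomogeneous i) ∧
      restr w h f =
        ∑ r ∈ R, restr w h (g r) * ∏ r' ∈ R.erase r, restr w h (linForm r') := by
  induction hR using Finset.Nonempty.cons_induction with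
  | singleton r =>
    intro _ _ i f hf
    exact ⟨fun _ => f, fun _ => by simpa using hf, by simp⟩
  | cons r R hrR hR ih =>
    intro hh hind i f hf
    simp only [Finset.cons_eq_insert] at hh hind hf ⊢
    have hcard : 1 ≤ R.card := hR.card_pos
    rw [Finset.card_insert_of_notMem hrR, Nat.add_sub_cancel] at hf
    have hrh := hh r (Finset.mem_insert_self _ _)
    obtain ⟨z, hz0, hhz, hrz⟩ := exists_common_zero h0 hrh
    obtain ⟨l, hl⟩ := exists_dotProduct_eq_one hz0
    rw [dotProduct_comm] at hl
    have hP : eval z (∏ r' ∈ R, linForm r') ≠ 0 := by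
      rw [map_prod]
      refine Finset.prod_ne_zero_iff.2 fun r' hr' => ?_
      rw [eval_linForm]
      intro e
      obtain ⟨s, t, e⟩ := exists_eq_comb_of_dotProduct_eq_zero h0 hrh hz0 hhz hrz e
      exact hind r' (Finset.mem_insert_of_mem hr') r (Finset.mem_insert_self _ _)
        (fun e => hrR (e ▸ hr')) s t e
    set P := ∏ r' ∈ R, linForm r' with hPdef
    have hPh : P.IsHomogeneous R.card := by
      simpa using IsHomogeneous.prod R linForm (fun _ => 1) fun v _ => linForm_isHomogeneous v
    set c := eval z f / eval z P with hc
    have hgh : (C c * linForm l ^ i).IsHomogeneous i := by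
      simpa using ((linForm_isHomogeneous l).pow i).C_mul c
    have hFh : (f - C c * linForm l ^ i * P).IsHomogeneous (i + R.card) := hf.sub (hgh.mul hPh)
    have hF := mem_span_pair_of_eval_eq_zero h0 hrh hz0 hhz hrz hFh (by
      rw [map_sub, map_mul, map_mul, map_pow, eval_linForm, hl, eval_C, one_pow, mul_one, hc,
        div_mul_cancel₀ _ hP, sub_self])
    obtain ⟨x, y, hxy⟩ := Ideal.mem_span_pair.1 hF
    have hxy' := congrArg (restr w h) hxy
    rw [map_add, map_mul, map_mul, restr_self hw, mul_zero, add_zero] at hxy'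
    have hxh : (restr w h x).IsHomogeneous (i + (R.card - 1)) := by
      refine isHomogeneous_of_mul (restr_isHomogeneous w h (linForm_isHomogeneous r))
        (restr_linForm_ne_zero w (hh r (Finset.mem_insert_self _ _))) ?_
      rw [hxy', add_assoc, Nat.sub_add_cancel hcard]
      exact restr_isHomogeneous w h hFh
    obtain ⟨g, hg, hsum⟩ := ih (fun r' hr' => hh r' (Finset.mem_insert_of_mem hr'))
      (fun r₁ h₁ r₂ h₂ => hind r₁ (Finset.mem_insert_of_mem h₁) r₂ (Finset.mem_insert_of_mem h₂))
      i _ hxh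
    rw [restr_restr hw] at hsum
    refine ⟨Function.update g r (C c * linForm l ^ i), fun r' => ?_, ?_⟩
    · by_cases hr' : r' = r
      · subst hr'; simpa using hgh
      · simpa [hr'] using hg r'
    · rw [Finset.sum_insert hrR, Function.update_self, Finset.erase_insert hrR]
      have e1 : ∑ r' ∈ R, restr w h (Function.update g r (C c * linForm l ^ i) r') *
            ∏ r'' ∈ (insert r R).erase r', restr w h (linForm r'') =
          restr w h x * restr w h (linForm r) := by
        rw [hsum, Finset.sum_mul]
        refine Finset.sum_congr rfl fun r' hr' => ?_
        have hne : r' ≠ r := fun e => hrR (e ▸ hr')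
        rw [Function.update_of_ne hne, Finset.erase_insert_of_ne hne.symm,
          Finset.prod_insert (fun hm => hrR (Finset.mem_of_mem_erase hm))]
        ring
      rw [e1, hxy', map_sub, map_mul _ _ P, hPdef, map_prod]
      ring

/-- The homogeneous logarithmic derivations of degree `k`. -/
def derSub (V : Finset (Fin 3 → K)) (k : ℕ) : Submodule K (Fin 3 → MvPolynomial (Fin 3) K) where
  carrier := {θ | InD V θ ∧ HomogDer3 θ k}
  add_mem' := fun {θ θ'} h h' => ⟨fun v hv => by
    rw [derVal_add]; exact dvd_add (h.1 v hv) (h'.1 v hv), fun i => (h.2 i).add (h'.2 i)⟩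
  zero_mem' := ⟨fun v _ => by simp [derVal], fun i => isHomogeneous_zero _ _ _⟩
  smul_mem' := fun c θ h => by
    have e : c • θ = (C c : MvPolynomial (Fin 3) K) • θ := by
      ext1 i; simp [smul_eq_C_mul]
    rw [e]
    refine ⟨fun v hv => ?_, fun i => (h.2 i).C_mul c⟩
    rw [derVal_mul]
    exact (h.1 v hv).mul_left _

lemma mem_derSub {V : Finset (Fin 3 → K)} {k : ℕ} {θ : Fin 3 → MvPolynomial (Fin 3) K} :
    θ ∈ derSub V k ↔ InD V θ ∧ HomogDer3 θ k := Iff.rfl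

lemma finite_homogeneousSubmodule (j : ℕ) : Module.Finite K (homogeneousSubmodule (Fin 3) K j) :=
  Module.Finite.iff_fg.2 (homogeneousSubmodule_fg (Fin 3) K j)

lemma two_mul_finrank_homogeneousSubmodule (j : ℕ) :
    2 * Module.finrank K (homogeneousSubmodule (Fin 3) K j) = (j + 1) * (j + 2) := by
  have e : Module.finrank K (homogeneousSubmodule (Fin 3) K j) =
      Nat.card {d : Fin 3 →₀ ℕ | d.degree = j} := by
    rw [homogeneousSubmodule_eq_finsupp_supported]
    exact Module.finrank_eq_nat_card_basis (basisRestrictSupport K _)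
  have e2 : {d : Fin 3 →₀ ℕ | d.degree = j} =
      ((Finset.univ : Finset (Fin 3)).finsuppAntidiag j : Set (Fin 3 →₀ ℕ)) := by
    ext d
    simp [Finset.mem_finsuppAntidiag, Finsupp.degree_eq_sum]
  have e3 : ((Finset.univ : Finset (Fin 3)).finsuppAntidiag j).card = (j + 2).choose 2 := by
    rw [Finset.card_finsuppAntidiag_nat_eq_choose, ← Nat.choose_symm_add]
    simp [add_comm]
  have e4 : Nat.card {d : Fin 3 →₀ ℕ | d.degree = j} = (j + 2).choose 2 := by
    rw [e2, ← e3]; exact Nat.card_eq_finsetCard _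
  rw [e, e4, Nat.choose_two_right, Nat.mul_div_cancel' (Nat.even_mul_pred_self _).two_dvd]
  simp [mul_comm]

lemma finite_derSub (V : Finset (Fin 3 → K)) (k : ℕ) : Module.Finite K (derSub V k) := by
  have := finite_homogeneousSubmodule (K := K) k
  let f : derSub V k →ₗ[K] (Fin 3 → homogeneousSubmodule (Fin 3) K k) :=
    { toFun := fun θ i => ⟨θ.1 i, θ.2.2 i⟩
      map_add' := fun _ _ => rfl
      map_smul' := fun _ _ => rfl }
  refine Module.Finite.of_injective f fun θ θ' h => Subtype.ext (funext fun i => ?_)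
  exact congrArg Subtype.val (congrFun h i)

lemma finrank_map_add_finrank_inf_ker {M N : Type*} [AddCommGroup M] [Module K M]
    [AddCommGroup N] [Module K N] (f : M →ₗ[K] N) (p : Submodule K M) [Module.Finite K p] :
    Module.finrank K (p.map f) + Module.finrank K ↥(p ⊓ LinearMap.ker f) =
      Module.finrank K p := by
  have h := LinearMap.finrank_range_add_finrank_ker (f.domRestrict p)
  rw [LinearMap.range_domRestrict] at h
  rw [← h, ← Submodule.map_comap_subtype]
  congr 1
  rw [LinearMap.ker_domRestrict]
  exact (LinearEquiv.finrank_eq (Submodule.equivSubtypeMap p _)).symm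

lemma finrank_map_mulLeft {β : MvPolynomial (Fin 3) K} (hβ : β ≠ 0)
    (p : Submodule K (MvPolynomial (Fin 3) K)) :
    Module.finrank K (p.map (LinearMap.mulLeft K β)) = Module.finrank K p :=
  (LinearEquiv.finrank_eq (Submodule.equivMapOfInjective _
    (fun _ _ h => mul_left_cancel₀ hβ h) p)).symm

lemma finrank_map_restr {w h : Fin 3 → K} (hw : h ⬝ᵥ w = 1) (h0 : h ≠ 0) (j : ℕ) :
    Module.finrank K ((homogeneousSubmodule (Fin 3) K (j + 1)).map (restr w h).toLinearMap) =
      j + 2 := by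
  have := finite_homogeneousSubmodule (K := K) (j + 1)
  have h1 := finrank_map_add_finrank_inf_ker (restr w h).toLinearMap
    (homogeneousSubmodule (Fin 3) K (j + 1))
  have h2 : homogeneousSubmodule (Fin 3) K (j + 1) ⊓ LinearMap.ker (restr w h).toLinearMap =
      (homogeneousSubmodule (Fin 3) K j).map (LinearMap.mulLeft K (linForm h)) := by
    ext f
    simp only [Submodule.mem_inf, LinearMap.mem_ker, AlgHom.toLinearMap_apply,
      mem_homogeneousSubmodule, Submodule.mem_map, LinearMap.mulLeft_apply, restr_eq_zero_iff hw]
    constructor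
    · rintro ⟨hf, g, rfl⟩
      rw [mul_comm] at hf
      exact ⟨g, isHomogeneous_of_mul (linForm_isHomogeneous h) (linForm_ne_zero h0) hf, rfl⟩
    · rintro ⟨g, hg, rfl⟩
      rw [add_comm]
      exact ⟨(linForm_isHomogeneous h).mul hg, dvd_mul_right _ _⟩
  rw [h2, finrank_map_mulLeft (linForm_ne_zero h0)] at h1
  have h3 := two_mul_finrank_homogeneousSubmodule (K := K) (j + 1)
  have h4 := two_mul_finrank_homogeneousSubmodule (K := K) j
  nlinarith

open Classical in
lemma exists_inD_restr_eq {V R : Finset (Fin 3 → K)} {w h : Fin 3 → K} (hw : h ⬝ᵥ w = 1)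
    (h0 : h ≠ 0) (hh : ∀ v ∈ V, ∀ c : K, v ≠ c • h) (hR : IsTransversal V R h)
    (hRne : R.Nonempty) {f : MvPolynomial (Fin 3) K} {k : ℕ} (hk : V.card ≤ k)
    (hf : f.IsHomogeneous (k - (V \ R).card)) :
    ∃ θ ∈ derSub V k, restr w h (derVal θ h) =
      (∏ v ∈ V \ R, restr w h (linForm v)) * restr w h f := by
  have hcard : (V \ R).card + R.card = V.card := Finset.card_sdiff_add_card_eq_card hR.subset
  have hRc : 1 ≤ R.card := hRne.card_pos
  obtain ⟨g, hg, hsum⟩ := exists_restr_eq_sum hw h0 hRne (fun r hr => hh r (hR.subset hr))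
    hR.indep (k + 1 - V.card) f (by convert hf using 1; omega)
  have hu : ∀ r ∈ R, ∃ u : Fin 3 → K, r ⬝ᵥ u = 0 ∧ h ⬝ᵥ u = 1 := by
    intro r hr
    have hr0 : r ≠ 0 := fun e => hh r (hR.subset hr) 0 (by simp [e])
    have hhr : ∀ c : K, h ≠ c • r := by
      intro c hc
      have hc0 : c ≠ 0 := fun e => h0 (by simp [hc, e])
      exact hh r (hR.subset hr) c⁻¹ (by rw [hc, smul_smul, inv_mul_cancel₀ hc0, one_smul])
    obtain ⟨x, hx⟩ := exists_dotProduct_eq_one hr0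
    obtain ⟨y, hy⟩ := exists_dotProduct_eq_one (h := h - (h ⬝ᵥ x) • r)
      fun e => hhr _ (sub_eq_zero.1 e)
    refine ⟨y - (r ⬝ᵥ y) • x, by simp [dotProduct_sub, hx], ?_⟩
    rw [← hy]
    simp [dotProduct_sub, sub_dotProduct, mul_comm]
  choose! u hu0 hu1 using hu
  have hmem : ∀ r ∈ R, (fun i => (g r * ∏ v ∈ V.erase r, linForm v) * C (u r i)) ∈
      derSub V k := by
    intro r hr
    rw [mem_derSub]
    refine ⟨fun v hv => ?_, fun i => ?_⟩
    · rw [derVal_mul_const]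
      by_cases hvr : v = r
      · rw [hvr, hu0 r hr, C_0, mul_zero]; exact dvd_zero _
      · exact ((Finset.dvd_prod_of_mem linForm
          (Finset.mem_erase.2 ⟨hvr, hv⟩)).mul_left _).mul_right _
    have hp := ((hg r).mul (IsHomogeneous.prod (V.erase r) linForm (fun _ => 1)
      fun v _ => linForm_isHomogeneous v)).C_mul (u r i)
    have hd : k + 1 - V.card + ∑ _v ∈ V.erase r, 1 = k := by
      rw [Finset.sum_const, Finset.card_erase_of_mem (hR.subset hr), smul_eq_mul, mul_one]
      omega
    rw [hd, mul_comm (C _)] at hp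
    exact hp
  refine ⟨∑ r ∈ R, fun i => (g r * ∏ v ∈ V.erase r, linForm v) * C (u r i),
    Submodule.sum_mem _ hmem, ?_⟩
  · have e1 : ∀ (s : Finset (Fin 3 → K)) (F : (Fin 3 → K) → Fin 3 → MvPolynomial (Fin 3) K),
        derVal (∑ r ∈ s, F r) h = ∑ r ∈ s, derVal (F r) h := by
      intro s F
      simp only [derVal, Finset.sum_apply, Finset.mul_sum]
      exact Finset.sum_comm
    rw [e1, map_sum, hsum, Finset.mul_sum]
    refine Finset.sum_congr rfl fun r hr => ?_
    rw [derVal_mul_const, hu1 r hr, C_1, mul_one, map_mul, map_prod]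
    have e2 : V.erase r = (V \ R) ∪ R.erase r := by
      ext v
      simp only [Finset.mem_erase, Finset.mem_union, Finset.mem_sdiff]
      constructor
      · rintro ⟨h1, h2⟩
        by_cases hvR : v ∈ R <;> simp [*]
      · rintro (⟨h1, h2⟩ | ⟨h1, h2⟩)
        · exact ⟨fun e => h2 (e ▸ hr), h1⟩
        · exact ⟨h1, hR.subset h2⟩
    rw [e2, Finset.prod_union]
    · ring
    · rw [Finset.disjoint_left]
      intro v hv hv'
      exact (Finset.mem_sdiff.1 hv).2 (Finset.mem_of_mem_erase hv')

open Classical in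
lemma finrank_derSub_insert {V R : Finset (Fin 3 → K)} {h : Fin 3 → K} (h0 : h ≠ 0)
    (hV : IsReduced V) (hh : ∀ v ∈ V, ∀ c : K, v ≠ c • h) (hR : IsTransversal V R h)
    (hRne : R.Nonempty) {k : ℕ} (hk : V.card ≤ k) :
    Module.finrank K (derSub V k) =
      Module.finrank K (derSub (insert h V) k) + (k - (V \ R).card + 1) := by
  obtain ⟨w, hw⟩ := exists_dotProduct_eq_one h0
  have := finite_derSub V k
  have hcard : (V \ R).card + R.card = V.card := Finset.card_sdiff_add_card_eq_card hR.subset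
  have hRc : 1 ≤ R.card := hRne.card_pos
  set β := ∏ v ∈ V \ R, restr w h (linForm v) with hβ
  have hβ0 : β ≠ 0 := Finset.prod_ne_zero_iff.2 fun v hv =>
    restr_linForm_ne_zero w (hh v (Finset.mem_sdiff.1 hv).1)
  have hβh : β.IsHomogeneous (V \ R).card := restr_prod_isHomogeneous w h (V \ R)
  let Φ : (Fin 3 → MvPolynomial (Fin 3) K) →ₗ[K] MvPolynomial (Fin 3) K :=
    { toFun := fun θ => restr w h (derVal θ h)
      map_add' := fun θ θ' => by rw [derVal_add, map_add]
      map_smul' := fun c θ => by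
        have e : c • θ = (C c : MvPolynomial (Fin 3) K) • θ := by
          ext1 i; simp [smul_eq_C_mul]
        rw [e, derVal_mul, ← smul_eq_C_mul, map_smul, RingHom.id_apply] }
  have h1 := finrank_map_add_finrank_inf_ker Φ (derSub V k)
  have hker : derSub V k ⊓ LinearMap.ker Φ = derSub (insert h V) k := by
    ext θ
    simp only [Submodule.mem_inf, LinearMap.mem_ker, mem_derSub, InD, Finset.forall_mem_insert]
    have : Φ θ = 0 ↔ linForm h ∣ derVal θ h := restr_eq_zero_iff hw _
    rw [this]
    tauto
  obtain ⟨j, hj⟩ : ∃ j, k - (V \ R).card = j + 1 := ⟨k - (V \ R).card - 1, by omega⟩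
  have hmap : (derSub V k).map Φ = ((homogeneousSubmodule (Fin 3) K (j + 1)).map
      (restr w h).toLinearMap).map (LinearMap.mulLeft K β) := by
    ext f
    simp only [Submodule.mem_map, LinearMap.mulLeft_apply, AlgHom.toLinearMap_apply,
      mem_homogeneousSubmodule, exists_exists_and_eq_and]
    constructor
    · rintro ⟨θ, hθ, rfl⟩
      obtain ⟨g, hg⟩ := prod_dvd_restr_derVal hw hV hh hR hθ.1
      have hg' : restr w h (derVal θ h) = β * restr w h g := by
        rw [← restr_restr hw, hg, map_mul]
        congr 1
        rw [hβ, map_prod]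
        exact Finset.prod_congr rfl fun v _ => restr_restr hw _
      refine ⟨restr w h g, ?_, by rw [restr_restr hw]; exact hg'.symm⟩
      refine isHomogeneous_of_mul hβh hβ0 ?_
      rw [mul_comm, ← hg', ← hj, Nat.sub_add_cancel (by omega)]
      exact restr_isHomogeneous w h (derVal_isHomogeneous hθ.2 h)
    · rintro ⟨g, hg, rfl⟩
      obtain ⟨θ, hθ, e⟩ := exists_inD_restr_eq hw h0 hh hR hRne hk (hj ▸ hg)
      exact ⟨θ, hθ, e⟩
  rw [hker, hmap, finrank_map_mulLeft hβ0, finrank_map_restr hw h0] at h1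
  omega

lemma IsDerBasis.finrank_derSub {V : Finset (Fin 3 → K)} {d₁ d₂ : ℕ}
    {θ₁ θ₂ : Fin 3 → MvPolynomial (Fin 3) K} (hb : IsDerBasis V d₁ d₂ θ₁ θ₂) (i i₁ i₂ k : ℕ)
    (hi : i + 1 = k) (hi₁ : i₁ + d₁ = k) (hi₂ : i₂ + d₂ = k) :
    2 * Module.finrank K (derSub V k) =
      (i + 1) * (i + 2) + (i₁ + 1) * (i₁ + 2) + (i₂ + 1) * (i₂ + 2) := by
  have := finite_homogeneousSubmodule (K := K) i
  have := finite_homogeneousSubmodule (K := K) i₁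
  have := finite_homogeneousSubmodule (K := K) i₂
  let H := homogeneousSubmodule (Fin 3) K
  let Ψ : (H i × H i₁ × H i₂) →ₗ[K] derSub V k :=
    { toFun := fun c => ⟨fun j => c.1.1 * X j + c.2.1.1 * θ₁ j + c.2.2.1 * θ₂ j,
        fun v hv => by
          rw [derVal_comb3]
          exact dvd_add (dvd_add (dvd_mul_left _ _) ((hb.mem₁ v hv).mul_left _))
            ((hb.mem₂ v hv).mul_left _),
        fun j => ((hi ▸ c.1.2.mul (isHomogeneous_X K j)).add
          (hi₁ ▸ c.2.1.2.mul (hb.homog₁ j))).add (hi₂ ▸ c.2.2.2.mul (hb.homog₂ j))⟩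
      map_add' := fun c c' => by
        refine Subtype.ext (funext fun j => ?_)
        simp only [Prod.fst_add, Prod.snd_add, Submodule.coe_add, Pi.add_apply]
        ring
      map_smul' := fun a c => by
        refine Subtype.ext (funext fun j => ?_)
        simp only [Prod.smul_fst, Prod.smul_snd, Submodule.coe_smul, Pi.smul_apply,
          RingHom.id_apply, smul_eq_C_mul]
        ring }
  have hΨ : Function.Bijective Ψ := by
    constructor
    · rw [← LinearMap.ker_eq_bot, LinearMap.ker_eq_bot']
      rintro ⟨p, q, r⟩ h
      obtain ⟨h1, h2, h3⟩ := hb.indep p.1 q.1 r.1 fun j =>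
        congrFun (congrArg Subtype.val h) j
      exact Prod.ext (Subtype.ext h1) (Prod.ext (Subtype.ext h2) (Subtype.ext h3))
    · rintro ⟨θ, hθ, hθk⟩
      obtain ⟨p, q, r, e⟩ := hb.spans θ hθ
      refine ⟨⟨⟨_, homogeneousComponent_mem i p⟩, ⟨_, homogeneousComponent_mem i₁ q⟩,
        ⟨_, homogeneousComponent_mem i₂ r⟩⟩, Subtype.ext (funext fun j => ?_)⟩
      change homogeneousComponent i p * X j + homogeneousComponent i₁ q * θ₁ j +
        homogeneousComponent i₂ r * θ₂ j = θ j
      rw [← homogeneousComponent_mul_add (isHomogeneous_X K j),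
        ← homogeneousComponent_mul_add (hb.homog₁ j),
        ← homogeneousComponent_mul_add (hb.homog₂ j), hi, hi₁, hi₂, ← map_add, ← map_add,
        ← homogeneousComponent_eq_self (hθk j), e]
  have h1 := (LinearEquiv.ofBijective Ψ hΨ).finrank_eq
  rw [Module.finrank_prod, Module.finrank_prod] at h1
  rw [← h1, mul_add, mul_add, two_mul_finrank_homogeneousSubmodule,
    two_mul_finrank_homogeneousSubmodule, two_mul_finrank_homogeneousSubmodule]
  ring

/-- The homogeneous coordinates of an affine point. -/
def homPt (p : K × K) : Fin 3 → K := ![p.1, p.2, 1]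

/-- The normal vector of the line at infinity. -/
def infty : Fin 3 → K := ![0, 0, 1]

open Classical in
/-- A normal vector of the homogenization of an affine line. -/
noncomputable def nrm (L : Set (K × K)) : Fin 3 → K :=
  if h : IsAffineLine L then ![h.choose, h.choose_spec.choose, h.choose_spec.choose_spec.choose]
  else 0

open Classical in
/-- The normal vectors of the cone of a line arrangement. -/
noncomputable def cone (A : Finset (Set (K × K))) : Finset (Fin 3 → K) :=
  insert infty (A.image nrm)

lemma infty_dotProduct_homPt (p : K × K) : infty ⬝ᵥ homPt p = 1 := by
  simp [infty, homPt, dotProduct, Fin.sum_univ_three]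

lemma homPt_ne_zero (p : K × K) : homPt p ≠ 0 := fun e => by simpa [homPt] using congrFun e 2

lemma nrm_spec {L : Set (K × K)} (hL : IsAffineLine L) :
    ((nrm L 0, nrm L 1) ≠ (0, 0)) ∧ ∀ p, p ∈ L ↔ nrm L ⬝ᵥ homPt p = 0 := by
  have h := hL.choose_spec.choose_spec.choose_spec
  have e : nrm L = ![hL.choose, hL.choose_spec.choose, hL.choose_spec.choose_spec.choose] := by
    rw [nrm, dif_pos hL]
  refine ⟨by rw [e]; exact h.1, fun p => ?_⟩
  rw [e]
  conv_lhs => rw [h.2]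
  simp [homPt, dotProduct, Fin.sum_univ_three]

lemma nrm_ne_smul_infty {L : Set (K × K)} (hL : IsAffineLine L) (c : K) : nrm L ≠ c • infty := by
  intro e
  exact (nrm_spec hL).1 (by rw [e]; simp [infty])

lemma nrm_ne_zero {L : Set (K × K)} (hL : IsAffineLine L) : nrm L ≠ 0 := by
  simpa using nrm_ne_smul_infty hL 0

lemma mem_iff_dotProduct {L : Set (K × K)} (hL : IsAffineLine L) (p : K × K) :
    p ∈ L ↔ nrm L ⬝ᵥ homPt p = 0 := (nrm_spec hL).2 p

/-- A plane containing an affine line is the homogenization of that line. -/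
lemma exists_eq_smul_of_vanish {v v' : Fin 3 → K} (hv : (v 0, v 1) ≠ (0, 0))
    (h : ∀ p : K × K, v ⬝ᵥ homPt p = 0 → v' ⬝ᵥ homPt p = 0) : ∃ c : K, v' = c • v := by
  simp only [homPt, dotProduct, Fin.sum_univ_three, Matrix.cons_val_zero, Matrix.cons_val_one,
    Matrix.cons_val, mul_one] at h
  by_cases h0 : v 0 = 0
  · have h1 : v 1 ≠ 0 := fun h1 => hv (by rw [h0, h1])
    have e1 := h (0, -v 2 / v 1) (by field_simp; ring)
    have e2 := h (1, -v 2 / v 1) (by rw [h0]; field_simp; ring)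
    have e3 : v' 0 = 0 := by linear_combination e2 - e1
    refine ⟨v' 1 / v 1, funext fun i => ?_⟩
    fin_cases i
    · simp [h0, e3]
    · simp [h1]
    · simp only [Fin.reduceFinMk, Pi.smul_apply, smul_eq_mul]
      linear_combination e1
  · have e1 := h (-v 2 / v 0, 0) (by field_simp; ring)
    have e2 := h ((-v 2 - v 1) / v 0, 1) (by field_simp; ring)
    refine ⟨v' 0 / v 0, funext fun i => ?_⟩
    fin_cases i
    · simp [h0]
    · simp only [Fin.mk_one, Pi.smul_apply, smul_eq_mul]
      linear_combination e2 - e1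
    · simp only [Fin.reduceFinMk, Pi.smul_apply, smul_eq_mul]
      linear_combination e1

lemma eq_of_nrm_eq_smul {L M : Set (K × K)} (hL : IsAffineLine L) (hM : IsAffineLine M) {c : K}
    (h : nrm L = c • nrm M) : L = M := by
  have hc : c ≠ 0 := fun e => nrm_ne_zero hL (by rw [h, e, zero_smul])
  ext p
  rw [mem_iff_dotProduct hL, mem_iff_dotProduct hM, h, smul_dotProduct, smul_eq_mul,
    mul_eq_zero, or_iff_right hc]

/-- Two distinct affine lines meet in at most one point. -/
lemma eq_of_mem_of_mem {L M : Set (K × K)} (hL : IsAffineLine L) (hM : IsAffineLine M)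
    (hLM : L ≠ M) {p q : K × K} (hpL : p ∈ L) (hpM : p ∈ M) (hqL : q ∈ L) (hqM : q ∈ M) :
    p = q := by
  by_contra hpq
  rw [mem_iff_dotProduct hL, dotProduct_comm] at hpL hqL
  rw [mem_iff_dotProduct hM, dotProduct_comm] at hpM hqM
  have hne : ∀ c : K, homPt p ≠ c • homPt q := by
    intro c hc
    have h2 : c = 1 := by simpa [homPt] using (congrFun hc 2).symm
    subst h2
    exact hpq (Prod.ext (by simpa [homPt] using congrFun hc 0)
      (by simpa [homPt] using congrFun hc 1))
  obtain ⟨c, hc⟩ := exists_eq_smul_of_vanish (v := nrm M) (v' := nrm L) (nrm_spec hM).1 (by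
    intro x hx
    obtain ⟨s, t, e⟩ := exists_eq_comb_of_dotProduct_eq_zero (homPt_ne_zero q) hne
      (nrm_ne_zero hM) hqM hpM (v := homPt x) (by rwa [dotProduct_comm])
    rw [e, dotProduct_comm, add_dotProduct, smul_dotProduct, smul_dotProduct, hpL, hqL]
    simp)
  exact hLM (eq_of_nrm_eq_smul hL hM hc)

open Classical in
lemma cone_insert (A : Finset (Set (K × K))) (H : Set (K × K)) :
    cone (insert H A) = insert (nrm H) (cone A) := by
  rw [cone, cone, Finset.image_insert, Finset.insert_comm]

open Classical in
lemma isReduced_cone {A : Finset (Set (K × K))} (hA : IsLineArr A) : IsReduced (cone A) := by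
  have hinf : (infty : Fin 3 → K) ≠ 0 := fun e => by simpa [infty] using congrFun e 2
  have hinf' : ∀ L ∈ A, ∀ c : K, infty ≠ c • nrm L := by
    intro L hL c hc
    have hc0 : c ≠ 0 := fun e => hinf (by rw [hc, e, zero_smul])
    exact nrm_ne_smul_infty (hA L hL) c⁻¹
      (by rw [hc, smul_smul, inv_mul_cancel₀ hc0, one_smul])
  constructor
  · intro v hv
    simp only [cone, Finset.mem_insert, Finset.mem_image] at hv
    rcases hv with rfl | ⟨L, hL, rfl⟩
    · exact hinf
    · exact nrm_ne_zero (hA L hL)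
  · intro v hv v' hv' hne c
    simp only [cone, Finset.mem_insert, Finset.mem_image] at hv hv'
    rcases hv with rfl | ⟨L, hL, rfl⟩ <;> rcases hv' with rfl | ⟨M, hM, rfl⟩
    · exact absurd rfl hne
    · exact hinf' M hM c
    · exact nrm_ne_smul_infty (hA L hL) c
    · intro e
      exact hne (congrArg nrm (eq_of_nrm_eq_smul (hA L hL) (hA M hM) e))

open Classical in
lemma card_cone {A : Finset (Set (K × K))} (hA : IsLineArr A) : (cone A).card = A.card + 1 := by
  rw [cone, Finset.card_insert_of_notMem, Finset.card_image_of_injOn]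
  · intro L hL M hM e
    exact eq_of_nrm_eq_smul (hA L hL) (hA M hM) (c := 1) (by rw [one_smul]; exact e)
  · simp only [Finset.mem_image, not_exists, not_and]
    intro L hL e
    exact nrm_ne_smul_infty (hA L hL) 1 (by rw [e, one_smul])

open Classical in
lemma ne_smul_nrm_of_mem_cone {A : Finset (Set (K × K))} (hA : IsLineArr A) {H : Set (K × K)}
    (hH : IsAffineLine H) (hHA : H ∉ A) : ∀ v ∈ cone A, ∀ c : K, v ≠ c • nrm H := by
  have hred : IsReduced (cone (insert H A)) := isReduced_cone fun L hL => by
    rcases Finset.mem_insert.1 hL with rfl | hL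
    exacts [hH, hA L hL]
  rw [cone_insert] at hred
  refine (hred.of_insert fun hm => ?_).2.2
  simp only [cone, Finset.mem_insert, Finset.mem_image] at hm
  rcases hm with hm | ⟨L, hL, hm⟩
  · exact nrm_ne_smul_infty hH 1 (by rw [hm, one_smul])
  · exact hHA (eq_of_nrm_eq_smul hH (hA L hL) (c := 1) (by rw [hm, one_smul]) ▸ hL)

lemma finite_points {A : Finset (Set (K × K))} (hA : IsLineArr A) {H : Set (K × K)}
    (hH : IsAffineLine H) : {p : K × K | p ∈ H ∧ ∃ L ∈ A, L ≠ H ∧ p ∈ L}.Finite := by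
  have : {p : K × K | p ∈ H ∧ ∃ L ∈ A, L ≠ H ∧ p ∈ L} ⊆
      ⋃ L ∈ A, {p : K × K | p ∈ H ∧ L ≠ H ∧ p ∈ L} := by
    rintro p ⟨hp, L, hL, hne, hpL⟩
    simp only [Set.mem_iUnion]
    exact ⟨L, hL, hp, hne, hpL⟩
  refine Set.Finite.subset (Set.Finite.biUnion A.finite_toSet fun L hL => ?_) this
  refine Set.Subsingleton.finite fun p hp q hq => ?_
  exact eq_of_mem_of_mem (hA L hL) hH hp.2.1 hp.2.2 hp.1 hq.2.2 hq.1

open Classical in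
lemma exists_isTransversal {A : Finset (Set (K × K))} (hA : IsLineArr A) {H : Set (K × K)}
    (hH : IsAffineLine H) (hHA : H ∉ A) :
    ∃ R, IsTransversal (cone A) R (nrm H) ∧ R.card = nOn A H + 1 := by
  have hfin := finite_points hA hH
  have hmem : ∀ p ∈ hfin.toFinset, p ∈ H ∧ ∃ L ∈ A, L ≠ H ∧ p ∈ L := fun p hp =>
    (Set.Finite.mem_toFinset hfin).1 hp
  have hpt : ∀ p ∈ hfin.toFinset, ∃ L ∈ A, L ≠ H ∧ p ∈ L := fun p hp => (hmem p hp).2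
  choose! l hlA hlH hpl using hpt
  have hn : nOn A H = hfin.toFinset.card := Set.ncard_eq_toFinset_card _ hfin
  have hH0 := nrm_ne_zero hH
  have hnot := ne_smul_nrm_of_mem_cone hA hH hHA
  have hinf_mem : infty ∈ cone A := Finset.mem_insert_self _ _
  have hnrm_mem : ∀ L ∈ A, nrm L ∈ cone A := fun L hL =>
    Finset.mem_insert_of_mem (Finset.mem_image_of_mem _ hL)
  have hz : ∀ p ∈ hfin.toFinset, nrm (l p) ⬝ᵥ homPt p = 0 ∧ nrm H ⬝ᵥ homPt p = 0 := fun p hp =>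
    ⟨(mem_iff_dotProduct (hA _ (hlA p hp)) p).1 (hpl p hp),
      (mem_iff_dotProduct hH p).1 (hmem p hp).1⟩
  refine ⟨insert infty (hfin.toFinset.image fun p => nrm (l p)), ⟨?_, ?_, ?_⟩, ?_⟩
  · intro v hv
    simp only [Finset.mem_insert, Finset.mem_image] at hv
    rcases hv with rfl | ⟨p, hp, rfl⟩
    exacts [hinf_mem, hnrm_mem _ (hlA p hp)]
  · intro v hv
    have hvH := hnot v hv
    simp only [cone, Finset.mem_insert, Finset.mem_image] at hv
    rcases hv with rfl | ⟨L, hL, rfl⟩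
    · exact ⟨infty, Finset.mem_insert_self _ _, 1, 0, by simp⟩
    · obtain ⟨z, hz0, hHz, hLz⟩ := exists_common_zero hH0 hvH
      by_cases hz2 : z 2 = 0
      · obtain ⟨s, t, e⟩ := exists_eq_comb_of_dotProduct_eq_zero hH0 (hnot _ hinf_mem) hz0 hHz
          (by simp [infty, dotProduct, Fin.sum_univ_three, hz2]) hLz
        exact ⟨infty, Finset.mem_insert_self _ _, s, t, e⟩
      · have hzp : homPt (z 0 / z 2, z 1 / z 2) = (z 2)⁻¹ • z := by
          ext i; fin_cases i <;> simp [homPt, hz2, div_eq_inv_mul]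
        have hpH : (z 0 / z 2, z 1 / z 2) ∈ H := by
          rw [mem_iff_dotProduct hH, hzp, dotProduct_smul, hHz, smul_zero]
        have hpL : (z 0 / z 2, z 1 / z 2) ∈ L := by
          rw [mem_iff_dotProduct (hA L hL), hzp, dotProduct_smul, hLz, smul_zero]
        have hp : (z 0 / z 2, z 1 / z 2) ∈ hfin.toFinset :=
          (Set.Finite.mem_toFinset hfin).2 ⟨hpH, L, hL, fun e => hHA (e ▸ hL), hpL⟩
        obtain ⟨s, t, e⟩ := exists_eq_comb_of_dotProduct_eq_zero hH0
          (hnot _ (hnrm_mem _ (hlA _ hp))) (homPt_ne_zero _) (hz _ hp).2 (hz _ hp).1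
          ((mem_iff_dotProduct (hA L hL) _).1 hpL)
        exact ⟨_, Finset.mem_insert_of_mem (Finset.mem_image_of_mem _ hp), s, t, e⟩
  · intro r hr r' hr' hne s t e
    simp only [Finset.mem_insert, Finset.mem_image] at hr hr'
    rcases hr with rfl | ⟨p, hp, rfl⟩ <;> rcases hr' with rfl | ⟨q, hq, rfl⟩
    · exact hne rfl
    · have := congrArg (· ⬝ᵥ homPt q) e
      simp [add_dotProduct, hz q hq, infty_dotProduct_homPt] at this
    · have := congrArg (· ⬝ᵥ homPt p) e
      simp only [add_dotProduct, smul_dotProduct, hz p hp, infty_dotProduct_homPt, smul_eq_mul,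
        mul_zero, mul_one, add_zero] at this
      rw [← this, zero_smul, zero_add] at e
      exact hnot _ (hnrm_mem _ (hlA p hp)) t e
    · have := congrArg (· ⬝ᵥ homPt q) e
      simp only [add_dotProduct, smul_dotProduct, hz q hq, smul_zero, add_zero] at this
      rw [← mem_iff_dotProduct (hA _ (hlA p hp))] at this
      have hpq := eq_of_mem_of_mem (hA _ (hlA p hp)) hH (hlH p hp) (hpl p hp) (hmem p hp).1
        this (hmem q hq).1
      exact hne (by rw [hpq])
  · rw [Finset.card_insert_of_notMem, Finset.card_image_of_injOn, hn]
    · intro p hp q hq e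
      have hlpq : l p = l q := eq_of_nrm_eq_smul (hA _ (hlA p hp)) (hA _ (hlA q hq)) (c := 1)
        (by rw [one_smul]; exact e)
      exact eq_of_mem_of_mem (hA _ (hlA p hp)) hH (hlH p hp) (hpl p hp) (hmem p hp).1
        (hlpq ▸ hpl q hq) (hmem q hq).1
    · simp only [Finset.mem_image, not_exists, not_and]
      intro p hp e
      exact nrm_ne_smul_infty (hA _ (hlA p hp)) 1 (by rw [e, one_smul])

lemma lin3_eq (a b c : K) : lin3 a b c = linForm ![a, b, c] := by
  simp [lin3, linForm, Fin.sum_univ_three]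

lemma applyDer3_linForm (θ : Fin 3 → MvPolynomial (Fin 3) K) (v : Fin 3 → K) :
    applyDer3 θ (linForm v) = derVal θ v := by
  simp only [applyDer3, linForm, derVal]
  refine Finset.sum_congr rfl fun i _ => ?_
  simp [pderiv_X, Pi.single_apply, mul_comm]

lemma linForm_infty : (linForm infty : MvPolynomial (Fin 3) K) = X 2 := by
  simp [linForm, infty, Fin.sum_univ_three]

lemma derVal_smul (θ : Fin 3 → MvPolynomial (Fin 3) K) (c : K) (v : Fin 3 → K) :
    derVal θ (c • v) = C c * derVal θ v := by
  simp [derVal, Finset.mul_sum, mul_assoc]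

open Classical in
lemma inDCone_iff {A : Finset (Set (K × K))} (hA : IsLineArr A)
    (θ : Fin 3 → MvPolynomial (Fin 3) K) : InDCone A θ ↔ InD (cone A) θ := by
  have hinf : (∃ g, applyDer3 θ (X 2) = g * (X 2 : MvPolynomial (Fin 3) K)) ↔
      linForm infty ∣ derVal θ infty := by
    rw [← applyDer3_linForm, linForm_infty, dvd_iff_exists_eq_mul_left]
  rw [InDCone, hinf]
  simp only [lin3_eq, applyDer3_linForm, ← dvd_iff_exists_eq_mul_left]
  constructor
  · rintro ⟨h1, h2⟩ v hv
    simp only [cone, Finset.mem_insert, Finset.mem_image] at hv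
    rcases hv with rfl | ⟨L, hL, rfl⟩
    · exact h2
    · have e : nrm L = ![nrm L 0, nrm L 1, nrm L 2] := by ext i; fin_cases i <;> rfl
      rw [e]
      refine h1 L hL _ _ _ (nrm_spec (hA L hL)).1 (Set.ext fun p => ?_)
      rw [mem_iff_dotProduct (hA L hL)]
      simp [homPt, dotProduct, Fin.sum_univ_three]
  · refine fun h => ⟨fun L hL a b c _ hLe => ?_, h _ (Finset.mem_insert_self _ _)⟩
    obtain ⟨k, hk⟩ := exists_eq_smul_of_vanish (v := nrm L) (v' := ![a, b, c])
      (nrm_spec (hA L hL)).1 fun p hp => by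
        have : p ∈ L := (mem_iff_dotProduct (hA L hL) p).2 hp
        rw [hLe] at this
        simpa [homPt, dotProduct, Fin.sum_univ_three] using this
    rw [hk, linForm_smul, derVal_smul]
    exact mul_dvd_mul_left _ (h _ (Finset.mem_insert_of_mem (Finset.mem_image_of_mem _ hL)))

lemma isFreeExp_iff {A : Finset (Set (K × K))} (hA : IsLineArr A) (d₁ d₂ : ℕ) :
    IsFreeExp A d₁ d₂ ↔ ∃ θ₁ θ₂, IsDerBasis (cone A) d₁ d₂ θ₁ θ₂ := by
  simp only [IsFreeExp, inDCone_iff hA]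
  refine exists_congr fun θ₁ => exists_congr fun θ₂ => ⟨?_, ?_⟩
  · rintro ⟨m1, m2, h1, h2, h⟩
    refine ⟨m1, m2, h1, h2, fun θ hθ => ?_, fun p q r e => ?_⟩
    · obtain ⟨⟨p, q, r⟩, e, -⟩ := h θ hθ
      exact ⟨p, q, r, e⟩
    · have hu := h (fun _ => 0) (fun v _ => by simp [derVal])
      have := hu.unique (y₁ := (p, q, r)) (y₂ := (0, 0, 0)) (funext fun j => (e j).symm)
        (by simp)
      simpa using this
  · intro hb
    refine ⟨hb.mem₁, hb.mem₂, hb.homog₁, hb.homog₂, fun θ hθ => ?_⟩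
    obtain ⟨p, q, r, e⟩ := hb.spans θ hθ
    refine ⟨(p, q, r), e, ?_⟩
    rintro ⟨p', q', r'⟩ e'
    obtain ⟨h1, h2, h3⟩ := hb.indep (p' - p) (q' - q) (r' - r) fun j => by
      have h := congrFun (e.symm.trans e') j
      simp only at h
      linear_combination -h
    rw [sub_eq_zero] at h1 h2 h3
    rw [h1, h2, h3]

open Classical in
lemma isDerBasis_cone_empty : ∃ θ₁ θ₂,
    IsDerBasis (cone (∅ : Finset (Set (K × K)))) 0 0 θ₁ θ₂ := by
  have hmem : ∀ θ, InD (cone (∅ : Finset (Set (K × K)))) θ ↔ X 2 ∣ θ 2 := by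
    intro θ
    rw [← linForm_infty]
    simp [InD, cone, derVal, infty, Fin.sum_univ_three]
  refine ⟨![1, 0, 0], ![0, 1, 0], (hmem _).2 (by simp), (hmem _).2 (by simp), ?_, ?_, ?_, ?_⟩
  · intro i; fin_cases i <;> simp [isHomogeneous_one, isHomogeneous_zero]
  · intro i; fin_cases i <;> simp [isHomogeneous_one, isHomogeneous_zero]
  · intro θ hθ
    obtain ⟨g, hg⟩ := (hmem θ).1 hθ
    refine ⟨g, θ 0 - g * X 0, θ 1 - g * X 1, funext fun j => ?_⟩
    fin_cases j
    · simp
    · simp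
    · simp [hg, mul_comm]
  · intro p q r h
    have h2 : p = 0 := by simpa using h 2
    subst h2
    exact ⟨rfl, by simpa using h 0, by simpa using h 1⟩

open Classical in
lemma b2_insert {A : Finset (Set (K × K))} (hA : IsLineArr A) {H : Set (K × K)}
    (hH : IsAffineLine H) (hHA : H ∉ A) : b2 (insert H A) = b2 A + nOn A H := by
  have hfin := finite_points hA hH
  have hn : nOn A H = hfin.toFinset.card := Set.ncard_eq_toFinset_card _ hfin
  have hmem : ∀ p, p ∈ hfin.toFinset ↔ p ∈ H ∧ ∃ L ∈ A, L ≠ H ∧ p ∈ L := fun p =>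
    Set.Finite.mem_toFinset hfin
  have hsum : b2 (insert H A) = b2 A + ∑ D ∈ A.powerset,
      (if 2 ≤ (insert H D).card ∧ (⋂ L ∈ insert H D, L).Nonempty
        then (-1 : ℤ) ^ (insert H D).card else 0) := by
    rw [b2, b2, Finset.sum_filter, Finset.sum_filter, Finset.sum_powerset_insert hHA]
  have hterm : ∀ D ∈ A.powerset,
      (if 2 ≤ (insert H D).card ∧ (⋂ L ∈ insert H D, L).Nonempty
        then (-1 : ℤ) ^ (insert H D).card else 0) =
      ∑ p ∈ hfin.toFinset, if D ≠ ∅ ∧ D ⊆ A.filter (p ∈ ·) then -(-1 : ℤ) ^ D.card else 0 := by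
    intro D hD
    rw [Finset.mem_powerset] at hD
    have hHD : H ∉ D := fun h => hHA (hD h)
    rw [Finset.card_insert_of_notMem hHD]
    rcases D.eq_empty_or_nonempty with rfl | ⟨M, hM⟩
    · simp
    have hD0 : D ≠ ∅ := Finset.ne_empty_of_mem hM
    have hMH : M ≠ H := fun e => hHD (e ▸ hM)
    have h2 : 2 ≤ D.card + 1 := by have := Finset.card_pos.2 ⟨M, hM⟩; omega
    have hsub : ∀ p, D ⊆ A.filter (p ∈ ·) ↔ ∀ L ∈ D, p ∈ L := fun p =>
      ⟨fun h L hL => (Finset.mem_filter.1 (h hL)).2,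
        fun h L hL => Finset.mem_filter.2 ⟨hD hL, h L hL⟩⟩
    by_cases hne : (⋂ L ∈ insert H D, L).Nonempty
    · obtain ⟨q, hq⟩ := hne
      rw [if_pos ⟨h2, q, hq⟩]
      simp only [Finset.mem_insert, Set.iInter_iInter_eq_or_left, Set.mem_inter_iff,
        Set.mem_iInter] at hq
      rw [Finset.sum_eq_single q, if_pos ⟨hD0, (hsub q).2 hq.2⟩, pow_succ]
      · ring
      · intro p hp hpq
        refine if_neg fun h => hpq ?_
        exact eq_of_mem_of_mem (hA M (hD hM)) hH hMH ((hsub p).1 h.2 M hM) ((hmem p).1 hp).1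
          (hq.2 M hM) hq.1
      · intro h
        exact absurd ((hmem q).2 ⟨hq.1, M, hD hM, hMH, hq.2 M hM⟩) h
    · rw [if_neg fun h => hne h.2]
      refine (Finset.sum_eq_zero fun p hp => if_neg fun h => hne ⟨p, ?_⟩).symm
      simp only [Finset.mem_insert, Set.iInter_iInter_eq_or_left, Set.mem_inter_iff,
        Set.mem_iInter]
      exact ⟨((hmem p).1 hp).1, (hsub p).1 h.2⟩
  have hpoint : ∀ p ∈ hfin.toFinset, (∑ D ∈ A.powerset,
      if D ≠ ∅ ∧ D ⊆ A.filter (p ∈ ·) then -(-1 : ℤ) ^ D.card else 0) = 1 := by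
    intro p hp
    obtain ⟨-, L, hL, -, hpL⟩ := (hmem p).1 hp
    have hne : (A.filter (p ∈ ·)).Nonempty := ⟨L, Finset.mem_filter.2 ⟨hL, hpL⟩⟩
    have h0 := Finset.sum_powerset_neg_one_pow_card_of_nonempty hne
    have hE : A.powerset.filter (fun D => D ≠ ∅ ∧ D ⊆ A.filter (p ∈ ·)) =
        (A.filter (p ∈ ·)).powerset.erase ∅ := by
      ext D
      simp only [Finset.mem_filter, Finset.mem_powerset, Finset.mem_erase]
      exact ⟨fun h => h.2, fun h => ⟨h.2.trans (Finset.filter_subset _ _), h⟩⟩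
    rw [← Finset.sum_filter, hE, Finset.sum_neg_distrib]
    rw [← Finset.add_sum_erase _ _ (Finset.empty_mem_powerset _), Finset.card_empty,
      pow_zero] at h0
    linarith
  rw [hsum, Finset.sum_congr rfl hterm, Finset.sum_comm, Finset.sum_congr rfl hpoint, hn]
  simp

lemma b2_empty : b2 (∅ : Finset (Set (K × K))) = 0 := by
  rw [b2]
  refine Finset.sum_eq_zero fun D hD => ?_
  simp only [Finset.powerset_empty, Finset.mem_filter, Finset.mem_singleton] at hD
  simp [hD.1] at hD

lemma nOn_mono {A B : Finset (Set (K × K))} (hA : IsLineArr A) (hBA : B ⊆ A)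
    {H : Set (K × K)} (hH : IsAffineLine H) : nOn B H ≤ nOn A H :=
  Set.ncard_le_ncard (fun _ ⟨hp, L, hL, h⟩ => ⟨hp, L, hBA hL, h⟩) (finite_points hA hH)

lemma isLineArr_mono {A B : Finset (Set (K × K))} (hA : IsLineArr A) (hBA : B ⊆ A) :
    IsLineArr B := fun L hL => hA L (hBA hL)

open Classical in
/-- The dimension of a high-degree part of the derivation module of the cone. -/
lemma finrank_derSub_cone (A : Finset (Set (K × K))) (hA : IsLineArr A) (k : ℕ)
    (hk : A.card + 1 ≤ k) :
    2 * (Module.finrank K (derSub (cone A) k) : ℤ) =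
      k * (k + 1) + 2 * ((k + 1) * (k + 2)) - 2 * A.card * (k + 1) + A.card * (A.card - 1)
        - 2 * b2 A := by
  induction A using Finset.induction_on with
  | empty =>
    obtain ⟨θ₁, θ₂, hb⟩ := isDerBasis_cone_empty (K := K)
    obtain ⟨i, rfl⟩ : ∃ i, k = i + 1 := ⟨k - 1, by simp at hk; omega⟩
    have := hb.finrank_derSub i (i + 1) (i + 1) (i + 1) rfl rfl rfl
    rw [b2_empty]
    zify at this
    push_cast
    rw [this]
    simp
    ring
  | insert H A hHA ih =>
    have hA' : IsLineArr A := isLineArr_mono hA (Finset.subset_insert _ _)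
    have hH : IsAffineLine H := hA H (Finset.mem_insert_self _ _)
    rw [Finset.card_insert_of_notMem hHA] at hk ⊢
    obtain ⟨R, hR, hRc⟩ := exists_isTransversal hA' hH hHA
    have hc := card_cone hA'
    have hsd : (cone A \ R).card + R.card = (cone A).card :=
      Finset.card_sdiff_add_card_eq_card hR.subset
    have h := finrank_derSub_insert (nrm_ne_zero hH) (isReduced_cone hA')
      (ne_smul_nrm_of_mem_cone hA' hH hHA) hR (Finset.card_pos.1 (by omega)) (k := k) (by omega)
    have ih' := ih hA' (by omega)
    rw [← cone_insert] at h
    have h' : Module.finrank K (derSub (cone A) k) + A.card =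
        Module.finrank K (derSub (cone (insert H A)) k) + k + nOn A H + 1 := by omega
    rw [b2_insert hA' hH hHA]
    zify at h'
    push_cast
    linear_combination ih' - 2 * h'

/-- Terao's factorization theorem for cones of affine line arrangements. -/
lemma IsDerBasis.add_and_mul_eq {A : Finset (Set (K × K))} (hA : IsLineArr A) {d₁ d₂ : ℕ}
    {θ₁ θ₂ : Fin 3 → MvPolynomial (Fin 3) K} (hb : IsDerBasis (cone A) d₁ d₂ θ₁ θ₂) :
    d₁ + d₂ = A.card ∧ (d₁ * d₂ : ℤ) = b2 A := by
  have h1 := hb.finrank_derSub (A.card + d₁ + d₂) (A.card + d₂ + 1) (A.card + d₁ + 1)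
    (A.card + d₁ + d₂ + 1) rfl (by ring) (by ring)
  have h2 := hb.finrank_derSub (A.card + d₁ + d₂ + 1) (A.card + d₂ + 2) (A.card + d₁ + 2)
    (A.card + d₁ + d₂ + 2) rfl (by ring) (by ring)
  have h3 := finrank_derSub_cone A hA (A.card + d₁ + d₂ + 1) (by omega)
  have h4 := finrank_derSub_cone A hA (A.card + d₁ + d₂ + 2) (by omega)
  zify at h1 h2
  rw [h1] at h3
  rw [h2] at h4
  push_cast at h3 h4
  have hs : (d₁ + d₂ : ℤ) = A.card := by linarith
  refine ⟨by exact_mod_cast hs, ?_⟩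
  have hd : (d₁ : ℤ) = A.card - d₂ := by linarith
  rw [hd] at h3 ⊢
  nlinarith [h3]

open Classical in
lemma IsDerBasis.le_nOn {B : Finset (Set (K × K))} (hB : IsLineArr B) {a b : ℕ}
    {θ₁ θ₂ : Fin 3 → MvPolynomial (Fin 3) K} (hb : IsDerBasis (cone B) a b θ₁ θ₂) (hab : a ≤ b)
    {H : Set (K × K)} (hH : IsAffineLine H) (hHB : H ∉ B) : a ≤ nOn B H := by
  obtain ⟨R, hR, hRc⟩ := exists_isTransversal hB hH hHB
  have hc := card_cone hB
  have hs := (hb.add_and_mul_eq hB).1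
  have hsd : (cone B \ R).card + R.card = (cone B).card :=
    Finset.card_sdiff_add_card_eq_card hR.subset
  have := hb.card_sdiff_le hab (nrm_ne_zero hH) (isReduced_cone hB)
    (ne_smul_nrm_of_mem_cone hB hH hHB) hR
  omega

open Classical in
lemma IsDerBasis.exists_cone_insert {B : Finset (Set (K × K))} (hB : IsLineArr B) {a b : ℕ}
    {θ₁ θ₂ : Fin 3 → MvPolynomial (Fin 3) K} (hb : IsDerBasis (cone B) a b θ₁ θ₂) (hab : a ≤ b)
    {H : Set (K × K)} (hH : IsAffineLine H) (hHB : H ∉ B) (hn : nOn B H = a) :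
    ∃ θ₁' θ₂', IsDerBasis (cone (insert H B)) a (b + 1) θ₁' θ₂' := by
  obtain ⟨R, hR, hRc⟩ := exists_isTransversal hB hH hHB
  have hc := card_cone hB
  have hs := (hb.add_and_mul_eq hB).1
  have hsd : (cone B \ R).card + R.card = (cone B).card :=
    Finset.card_sdiff_add_card_eq_card hR.subset
  rw [cone_insert]
  exact hb.exists_insert hab (nrm_ne_zero hH) (isReduced_cone hB)
    (ne_smul_nrm_of_mem_cone hB hH hHB) hR (by omega)

open Classical in
lemma b2_union_ge {A B : Finset (Set (K × K))} (hA : IsLineArr A) {a : ℕ}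
    (h : ∀ H ∈ A, H ∉ B → a ≤ nOn B H) (E : Finset (Set (K × K))) (hE : E ⊆ A \ B)
    {C : Finset (Set (K × K))} (hBC : B ⊆ C) (hCA : C ⊆ A) (hCE : Disjoint C E) :
    b2 C + a * E.card ≤ b2 (C ∪ E) := by
  induction E using Finset.induction_on with
  | empty => simp
  | insert H E hHE ih =>
    rw [Finset.insert_subset_iff] at hE
    rw [Finset.disjoint_insert_right] at hCE
    have hHA := (Finset.mem_sdiff.1 hE.1).1
    have hsub : C ∪ E ⊆ A := Finset.union_subset hCA (hE.2.trans Finset.sdiff_subset)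
    have hn : a ≤ nOn (C ∪ E) H := (h H hHA (Finset.mem_sdiff.1 hE.1).2).trans
      (nOn_mono (isLineArr_mono hA hsub) (hBC.trans Finset.subset_union_left) (hA H hHA))
    have ih' := ih hE.2 hCE.2
    rw [Finset.union_insert, Finset.card_insert_of_notMem hHE,
      b2_insert (isLineArr_mono hA hsub) (hA H hHA) (by simp [hCE.1, hHE])]
    push_cast
    have : (a : ℤ) ≤ nOn (C ∪ E) H := by exact_mod_cast hn
    linarith

open Classical in
lemma IsDerBasis.isFree_of_b2_eq {A : Finset (Set (K × K))} (hA : IsLineArr A) (n : ℕ) {a : ℕ} :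
    ∀ (B : Finset (Set (K × K))) (b : ℕ) (θ₁ θ₂ : Fin 3 → MvPolynomial (Fin 3) K),
      IsDerBasis (cone B) a b θ₁ θ₂ → B ⊆ A → (A \ B).card = n → a ≤ b →
      b2 A = b2 B + a * n → IsFree A := by
  induction n with
  | zero =>
    intro B b θ₁ θ₂ hb hBA hn hab _
    have : B = A := hBA.antisymm (Finset.sdiff_eq_empty_iff_subset.1 (Finset.card_eq_zero.1 hn))
    subst this
    exact ⟨a, b, (isFreeExp_iff hA a b).2 ⟨θ₁, θ₂, hb⟩⟩
  | succ n ih =>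
    intro B b θ₁ θ₂ hb hBA hn hab hb2
    have hB := isLineArr_mono hA hBA
    obtain ⟨H, hH⟩ : (A \ B).Nonempty := Finset.card_pos.1 (by omega)
    obtain ⟨hHA, hHB⟩ := Finset.mem_sdiff.1 hH
    have hins : insert H B ⊆ A := Finset.insert_subset hHA hBA
    have hsd : A \ insert H B = (A \ B).erase H := by
      ext L; simp only [Finset.mem_sdiff, Finset.mem_insert, Finset.mem_erase]; tauto
    have hcard : (A \ insert H B).card = n := by
      rw [hsd, Finset.card_erase_of_mem hH, hn, Nat.add_sub_cancel]
    have hge := b2_union_ge hA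
      (fun L hL hLB => hb.le_nOn hB hab (hA L hL) hLB) (A \ insert H B)
      (Finset.sdiff_subset_sdiff le_rfl (Finset.subset_insert _ _))
      (Finset.subset_insert H B) hins Finset.disjoint_sdiff
    rw [Finset.union_sdiff_of_subset hins, hcard] at hge
    have hins2 := b2_insert hB (hA H hHA) hHB
    have hle := hb.le_nOn hB hab (hA H hHA) hHB
    have hnOn : nOn B H = a := by
      have : (nOn B H : ℤ) ≤ a := by push_cast at hb2; linarith
      exact le_antisymm (by exact_mod_cast this) hle
    obtain ⟨θ₁', θ₂', hb'⟩ := hb.exists_cone_insert hB hab (hA H hHA) hHB hnOn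
    refine ih (insert H B) (b + 1) θ₁' θ₂' hb' hins hcard (by omega) ?_
    rw [hins2, hnOn, hb2]
    push_cast
    ring

lemma card_and_b2_of_chi {F : Type*} {A : Finset (Set (F × F))} {a c : ℕ}
    (h : ∀ t : ℂ, chi A t = (t - (a : ℂ)) * (t - (c : ℂ))) :
    A.card = a + c ∧ b2 A = a * c := by
  have h0 := h 0
  have h1 := h 1
  simp only [chi] at h0 h1
  have e2 : (b2 A : ℂ) = a * c := by linear_combination h0
  have e1 : (A.card : ℂ) = a + c := by linear_combination e2 - h1
  exact ⟨by exact_mod_cast e1, by exact_mod_cast e2⟩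

end LineArr

/-- **Proposition 2.10**. Let `A ⊇ B` be affine line arrangements with
`χ(A,t) = (t−a)(t−c)`, `χ(B,t) = (t−a)(t−b)`, `a, b, c ∈ ℤ_{≥0}`, `a ≤ b ≤ c`.
If `B` is free then `A` is free. -/
theorem free_of_free_subarrangement_sharing_root
    {K : Type*} [Field K] (A : Finset (Set (K × K))) (hA : IsLineArr A)
    (B : Finset (Set (K × K))) (hBA : B ⊆ A)
    (a b c : ℕ) (hab : a ≤ b) (hbc : b ≤ c)
    (hchiA : ∀ t : ℂ, chi A t = (t - (a : ℂ)) * (t - (c : ℂ)))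
    (hchiB : ∀ t : ℂ, chi B t = (t - (a : ℂ)) * (t - (b : ℂ)))
    (hBfree : IsFree B) :
    IsFree A := by
  classical
  obtain ⟨hAc, hAb⟩ := LineArr.card_and_b2_of_chi hchiA
  obtain ⟨hBc, hBb⟩ := LineArr.card_and_b2_of_chi hchiB
  have hB : IsLineArr B := fun L hL => hA L (hBA hL)
  obtain ⟨d₁, d₂, hfree⟩ := hBfree
  obtain ⟨θ₁, θ₂, hb⟩ := (LineArr.isFreeExp_iff hB d₁ d₂).1 hfree
  obtain ⟨hs, hp⟩ := hb.add_and_mul_eq hB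
  have hsum : (d₁ + d₂ : ℤ) = a + b := by exact_mod_cast hs.trans hBc
  have hroot : ((d₁ : ℤ) - a) * (d₁ - b) = 0 := by
    linear_combination d₁ * hsum - hp - hBb
  obtain ⟨θ₁', θ₂', hb'⟩ : ∃ θ₁' θ₂', LineArr.IsDerBasis (LineArr.cone B) a b θ₁' θ₂' := by
    rcases mul_eq_zero.1 hroot with h | h
    · obtain rfl : d₁ = a := by omega
      obtain rfl : d₂ = b := by omega
      exact ⟨θ₁, θ₂, hb⟩
    · obtain rfl : d₁ = b := by omega
      obtain rfl : d₂ = a := by omega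
      exact ⟨θ₂, θ₁, hb.symm⟩
  refine LineArr.IsDerBasis.isFree_of_b2_eq hA (A \ B).card B b θ₁' θ₂' hb' hBA rfl hab ?_
  have hsd : (A \ B).card + B.card = A.card := Finset.card_sdiff_add_card_eq_card hBA
  have hsd' : ((A \ B).card : ℤ) = c - b := by omega
  rw [hAb, hBb, hsd']
  ring
end

section
/- Let F_q be a finite field with q elements and let (A, m) be a multiarrangement on a central line arrangement A in F_q², with exp(A,m) = (d₁,d₂), d₁ ≤ d₂. Assume m(H) ≤ q for every H ∈ A. Then: (1) the inequality d₁ < q < d₂ cannot occur; (2) if |m| ≥ 2q, then d₁ = q; and (3) if |m| = 2q − 1, then d₂ = q. -/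
open MvPolynomial

variable {K : Type*} [Field K]

/-- A subset of `K × K` is a line through the origin. -/
def IsCentralLine (L : Set (K × K)) : Prop :=
  ∃ a b : K, (a, b) ≠ (0, 0) ∧ L = {p : K × K | a * p.1 + b * p.2 = 0}

/-- A central line arrangement: a finite set of lines through the origin of `K²`. -/
def IsCentralArr (A : Finset (Set (K × K))) : Prop :=
  ∀ L ∈ A, IsCentralLine L

/-- The linear form `a·x + b·y` in `K[x,y]`. -/
noncomputable def lin2 (a b : K) : MvPolynomial (Fin 2) K :=
  C a * X 0 + C b * X 1

/-- The action on `f` of the derivation with coefficient vector `θ`. -/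
noncomputable def applyDer2 (θ : Fin 2 → MvPolynomial (Fin 2) K)
    (f : MvPolynomial (Fin 2) K) : MvPolynomial (Fin 2) K :=
  ∑ i, θ i * pderiv i f

/-- `θ` belongs to `D(A,m)`, the logarithmic derivation module of the multiarrangement
`(A, m)`: `θ(α_H) ∈ S'·α_H^{m(H)}` for every `H ∈ A`. -/
def InDm (A : Finset (Set (K × K))) (m : Set (K × K) → ℕ)
    (θ : Fin 2 → MvPolynomial (Fin 2) K) : Prop :=
  ∀ L ∈ A, ∀ a b : K, (a, b) ≠ (0, 0) →
    L = {p : K × K | a * p.1 + b * p.2 = 0} →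
    ∃ g, applyDer2 θ (lin2 a b) = g * lin2 a b ^ m L

/-- A homogeneous derivation of degree `d` on `K[x,y]`. -/
def HomogDer2 (θ : Fin 2 → MvPolynomial (Fin 2) K) (d : ℕ) : Prop :=
  ∀ i, (θ i).IsHomogeneous d

/-- `exp(A,m) = (d₁,d₂)`: the free module `D(A,m)` has a homogeneous basis with degrees
`d₁` and `d₂`. -/
def IsExpPair (A : Finset (Set (K × K))) (m : Set (K × K) → ℕ) (d₁ d₂ : ℕ) : Prop :=
  ∃ θ₁ θ₂ : Fin 2 → MvPolynomial (Fin 2) K,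
    InDm A m θ₁ ∧ InDm A m θ₂ ∧ HomogDer2 θ₁ d₁ ∧ HomogDer2 θ₂ d₂ ∧
    ∀ θ : Fin 2 → MvPolynomial (Fin 2) K, InDm A m θ →
      ∃! cfs : MvPolynomial (Fin 2) K × MvPolynomial (Fin 2) K,
        θ = fun j => cfs.1 * θ₁ j + cfs.2 * θ₂ j

/-- `|m| = ∑_{H ∈ A} m(H)`. -/
def msize (A : Finset (Set (K × K))) (m : Set (K × K) → ℕ) : ℕ := ∑ H ∈ A, m H

theorem applyDer2_lin2 (θ : Fin 2 → MvPolynomial (Fin 2) K) (a b : K) :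
    applyDer2 θ (lin2 a b) = C a * θ 0 + C b * θ 1 := by
  simp [applyDer2, lin2, Fin.sum_univ_two, pderiv_X, Pi.single_apply]
  ring

theorem lin2_isHomogeneous (a b : K) : (lin2 a b).IsHomogeneous 1 :=
  (isHomogeneous_C_mul_X a 0).add (isHomogeneous_C_mul_X b 1)

theorem lin2_ne_zero {a b : K} (h : (a, b) ≠ (0, 0)) : lin2 a b ≠ 0 := by
  intro h0
  apply h
  have h1 := congrArg (coeff (Finsupp.single 0 1)) h0
  have h2 := congrArg (coeff (Finsupp.single 1 1)) h0
  simp [lin2, coeff_C_mul, coeff_X, Finsupp.single_left_inj] at h1 h2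
  simp [h1, h2]

theorem lin2_smul (c a b : K) : lin2 (c * a) (c * b) = C c * lin2 a b := by
  simp [lin2]
  ring

/-- Two equations of the same central line are proportional. -/
theorem exists_smul_of_line_eq {a b a' b' : K} (h : (a, b) ≠ (0, 0)) (h' : (a', b') ≠ (0, 0))
    (hL : {p : K × K | a * p.1 + b * p.2 = 0} = {p : K × K | a' * p.1 + b' * p.2 = 0}) :
    ∃ c : K, c ≠ 0 ∧ a' = c * a ∧ b' = c * b := by
  have h1 : (b, -a) ∈ {p : K × K | a' * p.1 + b' * p.2 = 0} := by
    rw [← hL]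
    simp only [Set.mem_ofPred_eq]
    ring
  simp only [Set.mem_ofPred_eq] at h1
  by_cases ha : a = 0
  · have hb : b ≠ 0 := fun hb => h (by simp [ha, hb])
    have ha' : a' = 0 := by simpa [ha, hb] using h1
    refine ⟨b' / b, div_ne_zero (fun hb' => h' (by simp [ha', hb'])) hb, by simp [ha, ha'],
      by field_simp⟩
  · have hb' : b' = a' / a * b := by
      field_simp
      linear_combination -h1
    refine ⟨a' / a, div_ne_zero (fun ha' => h' ?_) ha, by field_simp, hb'⟩
    simp [hb', ha']

theorem line_eq_of_det_eq_zero {a b a' b' : K} (h : (a, b) ≠ (0, 0)) (h' : (a', b') ≠ (0, 0))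
    (hdet : a * b' - b * a' = 0) :
    {p : K × K | a * p.1 + b * p.2 = 0} = {p : K × K | a' * p.1 + b' * p.2 = 0} := by
  have key : ∀ {a b a' b' : K}, (a, b) ≠ (0, 0) → a * b' - b * a' = 0 → ∀ p : K × K,
      a * p.1 + b * p.2 = 0 → a' * p.1 + b' * p.2 = 0 := by
    intro a b a' b' h hdet p hp
    by_cases ha : a = 0
    · have hb : b ≠ 0 := fun hb => h (by simp [ha, hb])
      apply mul_left_cancel₀ hb
      linear_combination b' * hp - p.1 * hdet
    · apply mul_left_cancel₀ ha
      linear_combination a' * hp + p.2 * hdet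
  ext p
  exact ⟨key h hdet p, key h' (by linear_combination -hdet) p⟩

theorem isRelPrime_X : IsRelPrime (X 0 : MvPolynomial (Fin 2) K) (X 1) :=
  (X_prime.irreducible.isRelPrime_iff_not_dvd).2 (by simp [X_dvd_X])

theorem isRelPrime_lin2 {a b a' b' : K} (hdet : a * b' - b * a' ≠ 0) :
    IsRelPrime (lin2 a b) (lin2 a' b') := by
  intro d h h'
  have hu : (C (a * b' - b * a')⁻¹ : MvPolynomial (Fin 2) K) * C (a * b' - b * a') = 1 := by
    rw [← C_mul, inv_mul_cancel₀ hdet, C_1]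
  simp only [C_sub, C_mul] at hu
  apply isRelPrime_X (K := K)
  · have : (X 0 : MvPolynomial (Fin 2) K) =
        C (a * b' - b * a')⁻¹ * (C b' * lin2 a b - C b * lin2 a' b') := by
      simp only [lin2]
      linear_combination -X 0 * hu
    rw [this]
    exact Dvd.dvd.mul_left (dvd_sub (h.mul_left _) (h'.mul_left _)) _
  · have : (X 1 : MvPolynomial (Fin 2) K) =
        C (a * b' - b * a')⁻¹ * (C a * lin2 a' b' - C a' * lin2 a b) := by
      simp only [lin2]
      linear_combination -X 1 * hu
    rw [this]
    exact Dvd.dvd.mul_left (dvd_sub (h'.mul_left _) (h.mul_left _)) _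

theorem homogeneousComponent_mul_eq_sum {σ R : Type*} [CommSemiring R]
    {f g : MvPolynomial σ R} {d n : ℕ} (hg : g.IsHomogeneous d) :
    homogeneousComponent n (f * g) = ∑ i ∈ Finset.range (f.totalDegree + 1),
      if i + d = n then homogeneousComponent i f * g else 0 := by
  conv_lhs => rw [← sum_homogeneousComponent f, Finset.sum_mul, map_sum]
  exact Finset.sum_congr rfl fun i _ => by
    rw [homogeneousComponent_of_mem ((homogeneousComponent_isHomogeneous i f).mul hg)]
    simp only [eq_comm]

theorem homogeneousComponent_mul_of_isHomogeneous {σ R : Type*} [CommSemiring R]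
    {f g : MvPolynomial σ R} {d n : ℕ} (hg : g.IsHomogeneous d) (h : d ≤ n) :
    homogeneousComponent n (f * g) = homogeneousComponent (n - d) f * g := by
  rw [homogeneousComponent_mul_eq_sum hg, Finset.sum_eq_single (n - d)]
  · rw [if_pos (Nat.sub_add_cancel h)]
  · intro i _ hi
    exact if_neg (by omega)
  · intro hmem
    rw [Finset.mem_range, not_lt] at hmem
    rw [homogeneousComponent_eq_zero _ _ (by omega), zero_mul, ite_self]

theorem homogeneousComponent_mul_of_isHomogeneous_of_lt {σ R : Type*} [CommSemiring R]
    {f g : MvPolynomial σ R} {d n : ℕ} (hg : g.IsHomogeneous d) (h : n < d) :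
    homogeneousComponent n (f * g) = 0 := by
  rw [homogeneousComponent_mul_eq_sum hg]
  exact Finset.sum_eq_zero fun i _ => if_neg (by omega)

/-- A homogeneous derivation in the span of two homogeneous derivations of larger degree is
zero. -/
theorem eq_zero_of_homogDer2_of_lt {θ θ₁ θ₂ : Fin 2 → MvPolynomial (Fin 2) K} {n d₁ d₂ : ℕ}
    (hθ : HomogDer2 θ n) (h₁ : HomogDer2 θ₁ d₁) (h₂ : HomogDer2 θ₂ d₂) (hn₁ : n < d₁)
    (hn₂ : n < d₂) {f g : MvPolynomial (Fin 2) K} (h : θ = fun j => f * θ₁ j + g * θ₂ j) :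
    θ = 0 := by
  funext j
  have hj := congrArg (homogeneousComponent n) (congrFun h j)
  rwa [homogeneousComponent_eq_self (hθ j), map_add,
    homogeneousComponent_mul_of_isHomogeneous_of_lt (h₁ j) hn₁,
    homogeneousComponent_mul_of_isHomogeneous_of_lt (h₂ j) hn₂, add_zero] at hj

/-- The Frobenius-type derivation `x^q ∂_x + y^q ∂_y` sends `α` to `α^q`. -/
theorem applyDer2_frobenius [Fintype K] (a b : K) :
    applyDer2 (fun i => X i ^ Fintype.card K) (lin2 a b) = lin2 a b ^ Fintype.card K := by
  obtain ⟨p, hp⟩ := CharP.exists K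
  obtain ⟨n, hprime, hcard⟩ := FiniteField.card K p
  have := Fact.mk hprime
  have ha := FiniteField.pow_card a
  have hb := FiniteField.pow_card b
  rw [applyDer2_lin2, lin2]
  rw [hcard] at ha hb ⊢
  rw [add_pow_char_pow, mul_pow, mul_pow, ← C_pow, ← C_pow, ha, hb]

theorem inDm_frobenius [Fintype K] {A : Finset (Set (K × K))} {m : Set (K × K) → ℕ}
    (hmq : ∀ H ∈ A, m H ≤ Fintype.card K) : InDm A m (fun i => X i ^ Fintype.card K) := by
  intro L hL a b _ _
  refine ⟨lin2 a b ^ (Fintype.card K - m L), ?_⟩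
  rw [applyDer2_frobenius, ← pow_add, Nat.sub_add_cancel (hmq L hL)]

theorem pow_dvd_det {A : Finset (Set (K × K))} {m : Set (K × K) → ℕ}
    {θ₁ θ₂ : Fin 2 → MvPolynomial (Fin 2) K} (h₁ : InDm A m θ₁) (h₂ : InDm A m θ₂)
    {L : Set (K × K)} (hL : L ∈ A) {a b : K} (hab : (a, b) ≠ (0, 0))
    (hLab : L = {p : K × K | a * p.1 + b * p.2 = 0}) :
    lin2 a b ^ m L ∣ θ₁ 0 * θ₂ 1 - θ₁ 1 * θ₂ 0 := by
  obtain ⟨g₁, hg₁⟩ := h₁ L hL a b hab hLab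
  obtain ⟨g₂, hg₂⟩ := h₂ L hL a b hab hLab
  rw [applyDer2_lin2] at hg₁ hg₂
  by_cases ha : a = 0
  · have hb : b ≠ 0 := fun hb => hab (by simp [ha, hb])
    have hu : (C b⁻¹ : MvPolynomial (Fin 2) K) * C b = 1 := by
      rw [← C_mul, inv_mul_cancel₀ hb, C_1]
    refine ⟨C b⁻¹ * (θ₁ 0 * g₂ - g₁ * θ₂ 0), ?_⟩
    linear_combination -(θ₁ 0 * θ₂ 1 - θ₁ 1 * θ₂ 0) * hu + C b⁻¹ * (θ₁ 0 * hg₂ - θ₂ 0 * hg₁)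
  · have hu : (C a⁻¹ : MvPolynomial (Fin 2) K) * C a = 1 := by
      rw [← C_mul, inv_mul_cancel₀ ha, C_1]
    refine ⟨C a⁻¹ * (g₁ * θ₂ 1 - θ₁ 1 * g₂), ?_⟩
    linear_combination -(θ₁ 0 * θ₂ 1 - θ₁ 1 * θ₂ 0) * hu + C a⁻¹ * (θ₂ 1 * hg₁ - θ₁ 1 * hg₂)

/-- If the determinant of two homogeneous logarithmic derivations does not vanish, then the sum
of their degrees is at least `|m|`. -/
theorem msize_le_of_det_ne_zero {A : Finset (Set (K × K))} (hA : IsCentralArr A)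
    {m : Set (K × K) → ℕ} {θ₁ θ₂ : Fin 2 → MvPolynomial (Fin 2) K} {d₁ d₂ : ℕ}
    (h₁ : InDm A m θ₁) (h₂ : InDm A m θ₂) (hd₁ : HomogDer2 θ₁ d₁) (hd₂ : HomogDer2 θ₂ d₂)
    (hdet : θ₁ 0 * θ₂ 1 - θ₁ 1 * θ₂ 0 ≠ 0) : msize A m ≤ d₁ + d₂ := by
  choose! a b hab hL using hA
  have hdvd : ∏ L ∈ A, lin2 (a L) (b L) ^ m L ∣ θ₁ 0 * θ₂ 1 - θ₁ 1 * θ₂ 0 := by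
    refine Finset.prod_dvd_of_isRelPrime ?_ fun L hLA =>
      pow_dvd_det h₁ h₂ hLA (hab L hLA) (hL L hLA)
    intro L hLA L' hLA' hne
    refine (isRelPrime_lin2 fun h0 => hne ?_).pow_left.pow_right
    rw [hL L hLA, hL L' hLA', line_eq_of_det_eq_zero (hab L hLA) (hab L' hLA') h0]
  have hhom : (∏ L ∈ A, lin2 (a L) (b L) ^ m L).IsHomogeneous (msize A m) :=
    IsHomogeneous.prod _ _ _ fun L _ => by
      simpa using (lin2_isHomogeneous (a L) (b L)).pow (m L)
  have hne : ∏ L ∈ A, lin2 (a L) (b L) ^ m L ≠ 0 :=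
    Finset.prod_ne_zero_iff.2 fun L hLA => pow_ne_zero _ (lin2_ne_zero (hab L hLA))
  have hdeg := totalDegree_le_of_dvd_of_isDomain hdvd hdet
  rw [hhom.totalDegree hne] at hdeg
  exact hdeg.trans
    (IsHomogeneous.totalDegree_le (.sub ((hd₁ 0).mul (hd₂ 1)) ((hd₁ 1).mul (hd₂ 0))))

theorem det_ne_zero_of_unique {θ₁ θ₂ : Fin 2 → MvPolynomial (Fin 2) K}
    (h : ∀ f g : MvPolynomial (Fin 2) K, (∀ j, f * θ₁ j + g * θ₂ j = 0) → f = 0 ∧ g = 0) :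
    θ₁ 0 * θ₂ 1 - θ₁ 1 * θ₂ 0 ≠ 0 := by
  intro h0
  have h1 := h (θ₂ 1) (-θ₁ 1) (by
    rw [Fin.forall_fin_two]
    exact ⟨by linear_combination h0, by ring⟩)
  have h2 := h (θ₂ 0) (-θ₁ 0) (by
    rw [Fin.forall_fin_two]
    exact ⟨by ring, by linear_combination -h0⟩)
  refine one_ne_zero (h 1 0 ?_).1
  rw [Fin.forall_fin_two]
  simp [neg_eq_zero.1 h1.2, neg_eq_zero.1 h2.2]

/-- The exponent vector of the monomial `x^i y^(n-i)`. -/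
noncomputable def binExp (n i : ℕ) : Fin 2 →₀ ℕ :=
  Finsupp.single 0 i + Finsupp.single 1 (n - i)

/-- In coordinates in which `α` is the first variable, divisibility of a form by `α^k` is the
vanishing of its first `k` coefficients. -/
theorem lin2_pow_dvd_of_coeff_eq_zero {a b c d : K} (hdet : a * d - b * c = 1) {n k : ℕ}
    {f : MvPolynomial (Fin 2) K} (hf : f.IsHomogeneous n)
    (h : ∀ i < k, coeff (binExp n i) (aeval ![lin2 d (-b), lin2 (-c) a] f) = 0) :
    lin2 a b ^ k ∣ f := by
  set g := aeval ![lin2 d (-b), lin2 (-c) a] f with hg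
  have hghom : g.IsHomogeneous n := by
    have := hf.aeval ![lin2 d (-b), lin2 (-c) a] (n := 1) (by
      rw [Fin.forall_fin_two]
      exact ⟨lin2_isHomogeneous _ _, lin2_isHomogeneous _ _⟩)
    rwa [one_mul] at this
  have hdvd : (X 0 : MvPolynomial (Fin 2) K) ^ k ∣ g := by
    rw [g.as_sum]
    refine Finset.dvd_sum fun s hs => ?_
    rw [X_pow_eq_monomial, monomial_dvd_monomial]
    refine ⟨Or.inr ?_, one_dvd _⟩
    rw [Finsupp.single_le_iff]
    by_contra hlt
    rw [mem_support_iff] at hs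
    have hsn : s.degree = n := by
      by_contra hne
      exact hs (hghom.coeff_eq_zero hne)
    rw [Finsupp.degree_eq_sum, Fin.sum_univ_two] at hsn
    refine hs ?_
    convert h (s 0) (not_le.1 hlt) using 2
    ext j
    fin_cases j
    · simp [binExp]
    · simp [binExp]
      omega
  have hd : (C a * C d - C b * C c : MvPolynomial (Fin 2) K) = 1 := by
    rw [← C_mul, ← C_mul, ← C_sub, hdet, C_1]
  have hback : aeval ![lin2 a b, lin2 c d] g = f := by
    have : (aeval ![lin2 a b, lin2 c d]).comp (aeval ![lin2 d (-b), lin2 (-c) a]) =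
        AlgHom.id K (MvPolynomial (Fin 2) K) := by
      apply algHom_ext
      rw [Fin.forall_fin_two]
      simp only [lin2, AlgHom.comp_apply, aeval_X, map_add, map_mul, map_neg, algHom_C,
        algebraMap_eq, Matrix.cons_val_zero, Matrix.cons_val_one, AlgHom.id_apply]
      exact ⟨by linear_combination X 0 * hd, by linear_combination X 1 * hd⟩
    rw [hg, ← AlgHom.comp_apply, this, AlgHom.id_apply]
  have := map_dvd (aeval ![lin2 a b, lin2 c d]) hdvd
  rwa [hback, map_pow, aeval_X, Matrix.cons_val_zero] at this

theorem exists_det_eq_one {a b : K} (h : (a, b) ≠ (0, 0)) : ∃ c d : K, a * d - b * c = 1 := by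
  by_cases ha : a = 0
  · have hb : b ≠ 0 := fun hb => h (by simp [ha, hb])
    exact ⟨-b⁻¹, 0, by field_simp; ring⟩
  · exact ⟨0, a⁻¹, by field_simp; ring⟩

/-- The binary form of degree `n` with a given coefficient vector. -/
noncomputable def binForm (K : Type*) [Field K] (n : ℕ) :
    (Fin (n + 1) → K) →ₗ[K] MvPolynomial (Fin 2) K :=
  Fintype.linearCombination K fun i : Fin (n + 1) => monomial (binExp n i) 1

theorem binForm_isHomogeneous {n : ℕ} (c : Fin (n + 1) → K) : (binForm K n c).IsHomogeneous n := by
  rw [binForm, Fintype.linearCombination_apply]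
  refine IsHomogeneous.sum _ _ _ fun i _ => ?_
  rw [smul_monomial]
  refine isHomogeneous_monomial _ ?_
  rw [Finsupp.degree_eq_sum, Fin.sum_univ_two]
  simp [binExp]
  omega

theorem binForm_injective (n : ℕ) : Function.Injective (binForm K n) := by
  apply LinearIndependent.fintypeLinearCombination_injective
  refine (basisMonomials (Fin 2) K).linearIndependent.comp (fun i : Fin (n + 1) => binExp n i) ?_
  intro i j hij
  have := DFunLike.congr_fun hij 0
  simpa [binExp, Fin.val_inj] using this

/-- If `|m| < 2 (n + 1)`, then `D(A,m)` contains a nonzero derivation of degree `n`. -/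
theorem exists_homogDer2_ne_zero {A : Finset (Set (K × K))} (hA : IsCentralArr A)
    {m : Set (K × K) → ℕ} {n : ℕ} (hn : msize A m < 2 * (n + 1)) :
    ∃ θ, InDm A m θ ∧ HomogDer2 θ n ∧ θ ≠ 0 := by
  choose! a b hab hL using hA
  have hcd : ∀ L ∈ A, ∃ c d : K, a L * d - b L * c = 1 := fun L hLA =>
    exists_det_eq_one (hab L hLA)
  choose! c d hdet using hcd
  let Φ : (Fin 2 → Fin (n + 1) → K) →ₗ[K] ((Σ L : A, Fin (m L)) → K) :=
    LinearMap.pi fun s => lcoeff K (binExp n s.2) ∘ₗ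
      (aeval ![lin2 (d s.1) (-b s.1), lin2 (-c s.1) (a s.1)]).toLinearMap ∘ₗ
      (a s.1 • binForm K n ∘ₗ LinearMap.proj 0 + b s.1 • binForm K n ∘ₗ LinearMap.proj 1)
  have hker : LinearMap.ker Φ ≠ ⊥ := by
    apply LinearMap.ker_ne_bot_of_finrank_lt
    simpa [msize, Finset.sum_attach A m, Module.finrank_pi_fintype] using hn
  obtain ⟨v, hv, hv0⟩ := (Submodule.ne_bot_iff _).1 hker
  refine ⟨fun j => binForm K n (v j), ?_, fun j => binForm_isHomogeneous _, fun h0 => hv0 ?_⟩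
  · intro L hLA a' b' hab' hL'
    obtain ⟨e, he, rfl, rfl⟩ := exists_smul_of_line_eq (hab L hLA) hab' ((hL L hLA).symm.trans hL')
    have hdvd : lin2 (a L) (b L) ^ m L ∣
        C (a L) * binForm K n (v 0) + C (b L) * binForm K n (v 1) := by
      refine lin2_pow_dvd_of_coeff_eq_zero (hdet L hLA)
        (((binForm_isHomogeneous _).C_mul _).add ((binForm_isHomogeneous _).C_mul _)) fun i hi => ?_
      have := congrFun (LinearMap.mem_ker.1 hv) ⟨⟨L, hLA⟩, ⟨i, hi⟩⟩
      simpa [Φ, smul_eq_C_mul] using this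
    have hu : (C e⁻¹ : MvPolynomial (Fin 2) K) * C e = 1 := by
      rw [← C_mul, inv_mul_cancel₀ he, C_1]
    obtain ⟨g, hg⟩ := hdvd
    rw [applyDer2_lin2, lin2_smul, mul_pow]
    refine ⟨C e * C e⁻¹ ^ m L * g, ?_⟩
    have hu' : (C e⁻¹ : MvPolynomial (Fin 2) K) ^ m L * C e ^ m L = 1 := by
      rw [← mul_pow, hu, one_pow]
    simp only [C_mul]
    linear_combination C e * hg - C e * g * lin2 (a L) (b L) ^ m L * hu'
  · funext j
    apply binForm_injective n
    rw [congrFun h0 j]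
    simp

/-- The Frobenius-type derivation is not a multiple of a derivation of smaller degree. -/
theorem not_frobenius_eq_mul {q d : ℕ} (hd : d < q) {θ : Fin 2 → MvPolynomial (Fin 2) K}
    (f : MvPolynomial (Fin 2) K) (hf : f.IsHomogeneous (q - d)) :
    ¬ ∀ i, X i ^ q = f * θ i := by
  intro h
  have hrel : IsRelPrime (X 0 ^ q : MvPolynomial (Fin 2) K) (X 1 ^ q) :=
    isRelPrime_X.pow_left.pow_right
  have hu : IsUnit f := hrel ⟨_, h 0⟩ ⟨_, h 1⟩
  have hdeg := totalDegree_le_of_dvd_of_isDomain hu.dvd (one_ne_zero (α := MvPolynomial (Fin 2) K))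
  rw [hf.totalDegree hu.ne_zero, totalDegree_one] at hdeg
  omega

/-- **Proposition 6.1**. Let `(A,m)` be a multiarrangement on a central line arrangement in
`𝔽_q²` with `m(H) ≤ q` for all `H`, and `exp(A,m) = (d₁,d₂)` with `d₁ ≤ d₂`. Then
(1) `d₁ < q < d₂` cannot occur; (2) if `|m| ≥ 2q` then `d₁ = q`; (3) if `|m| = 2q − 1`
then `d₂ = q`. -/
theorem finite_field_multiarrangement_exponents
    {K : Type*} [Field K] [Fintype K] (A : Finset (Set (K × K))) (hA : IsCentralArr A)
    (m : Set (K × K) → ℕ) (hm : ∀ H ∈ A, 1 ≤ m H)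
    (hmq : ∀ H ∈ A, m H ≤ Fintype.card K)
    (d₁ d₂ : ℕ) (hd : d₁ ≤ d₂) (hexp : IsExpPair A m d₁ d₂) :
    ¬ (d₁ < Fintype.card K ∧ Fintype.card K < d₂) ∧
    (2 * Fintype.card K ≤ msize A m → d₁ = Fintype.card K) ∧
    (msize A m = 2 * Fintype.card K - 1 → d₂ = Fintype.card K) := by
  obtain ⟨θ₁, θ₂, hθ₁, hθ₂, hd₁, hd₂, hbasis⟩ := hexp
  have hq : 0 < Fintype.card K := Fintype.card_pos
  have hfrob := inDm_frobenius hmq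
  have hfrobHom : HomogDer2 (fun i => (X i : MvPolynomial (Fin 2) K) ^ Fintype.card K)
      (Fintype.card K) := fun i => isHomogeneous_X_pow i _
  obtain ⟨⟨f, g⟩, hfg, -⟩ := hbasis _ hfrob
  have hpart : ¬ (d₁ < Fintype.card K ∧ Fintype.card K < d₂) := by
    rintro ⟨h₁, h₂⟩
    refine not_frobenius_eq_mul h₁ (θ := θ₁) _
      (homogeneousComponent_isHomogeneous (Fintype.card K - d₁) f) fun i => ?_
    have hi := congrArg (homogeneousComponent (Fintype.card K)) (congrFun hfg i)
    rwa [homogeneousComponent_eq_self (hfrobHom i), map_add,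
      homogeneousComponent_mul_of_isHomogeneous (hd₁ i) h₁.le,
      homogeneousComponent_mul_of_isHomogeneous_of_lt (hd₂ i) h₂, add_zero] at hi
  have hle : d₁ ≤ Fintype.card K := by
    by_contra! hlt
    have h0 := congrFun (eq_zero_of_homogDer2_of_lt hfrobHom hd₁ hd₂ hlt (hlt.trans_le hd) hfg) 0
    exact pow_ne_zero _ (X_ne_zero 0) h0
  have hsize : msize A m ≤ d₁ + d₂ := by
    refine msize_le_of_det_ne_zero hA hθ₁ hθ₂ hd₁ hd₂ (det_ne_zero_of_unique fun f g hzero => ?_)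
    have huniq := (hbasis 0 fun L _ a b _ _ => ⟨0, by simp [applyDer2_lin2]⟩).unique
      (y₁ := (f, g)) (y₂ := (0, 0)) (funext fun j => (hzero j).symm) (by funext j; simp)
    simpa using huniq
  refine ⟨hpart, fun hm2 => by omega, fun hm2 => ?_⟩
  obtain ⟨θ, hθ, hθd, hθ0⟩ := exists_homogDer2_ne_zero hA (m := m) (n := Fintype.card K - 1)
    (by omega)
  have hlt : d₁ < Fintype.card K := by
    by_contra! hge
    obtain ⟨⟨f', g'⟩, hfg', -⟩ := hbasis θ hθ
    exact hθ0 (eq_zero_of_homogDer2_of_lt hθd hd₁ hd₂ (by omega) (by omega) hfg')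
  omega
end

section
/- Let F_q be a finite field with q elements and let A be an affine line arrangement in V = F_q². If χ(A, q − 1) = 0, then A is free. -/
open MvPolynomial

variable {K : Type*} [Field K]

section LinearForms

lemma isHomogeneous_lin3 (a b c : K) : (lin3 a b c).IsHomogeneous 1 :=
  ((isHomogeneous_C_mul_X a 0).add (isHomogeneous_C_mul_X b 1)).add (isHomogeneous_C_mul_X c 2)

lemma lin3_ne_zero {a b c : K} (h : (a, b) ≠ (0, 0)) : lin3 a b c ≠ 0 := by
  intro h0
  apply h
  have h1 := congrArg (eval ![1, 0, 0]) h0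
  have h2 := congrArg (eval ![0, 1, 0]) h0
  simp [lin3] at h1 h2
  simp [h1, h2]

lemma prime_lin3 {a b c : K} (h : (a, b) ≠ (0, 0)) : Prime (lin3 a b c) := by
  have hd : (lin3 a b c).totalDegree = 1 := (isHomogeneous_lin3 a b c).totalDegree (lin3_ne_zero h)
  refine (irreducible_of_totalDegree_eq_one hd fun x hx => ?_).prime
  have h1 : coeff (Finsupp.single 0 1) (lin3 a b c) = a := by
    simp [lin3, coeff_C_mul, coeff_X, Finsupp.single_left_inj]
  have h2 : coeff (Finsupp.single 1 1) (lin3 a b c) = b := by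
    simp [lin3, coeff_C_mul, coeff_X, Finsupp.single_left_inj]
  rcases eq_or_ne x 0 with rfl | hx0
  · exact absurd (by
      have := hx (Finsupp.single 0 1); have h' := hx (Finsupp.single 1 1)
      rw [h1] at this; rw [h2] at h'
      simp_all) h
  · exact hx0.isUnit

lemma eval_lin3 (a b c : K) (p : K × K) :
    eval ![p.1, p.2, 1] (lin3 a b c) = a * p.1 + b * p.2 + c := by
  simp [lin3]

/-- If a line is contained in the zero set of a second equation, that equation is proportional
to the equation of the line. -/
lemma exists_lin3_eq_of_subset {a b c a' b' c' : K} (h : (a, b) ≠ (0, 0))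
    (hs : {p : K × K | a * p.1 + b * p.2 + c = 0} ⊆ {p : K × K | a' * p.1 + b' * p.2 + c' = 0}) :
    ∃ k : K, lin3 a' b' c' = C k * lin3 a b c := by
  suffices ∃ k : K, a' = k * a ∧ b' = k * b ∧ c' = k * c by
    obtain ⟨k, rfl, rfl, rfl⟩ := this
    exact ⟨k, by simp only [lin3, C_mul]; ring⟩
  rcases ne_or_eq a 0 with ha | rfl
  · have h1 : a' * (-c / a) + b' * 0 + c' = 0 := @hs (-c / a, 0) (by simp; field_simp; ring)
    have h2 : a' * ((-c - b) / a) + b' * 1 + c' = 0 :=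
      @hs ((-c - b) / a, 1) (by simp; field_simp; ring)
    refine ⟨a' / a, ?_, ?_, ?_⟩
    · field_simp
    · field_simp at h1 h2 ⊢; linear_combination h2 - h1
    · field_simp at h1 ⊢; linear_combination h1
  · have hb : b ≠ 0 := fun hb => h (by simp [hb])
    have h1 : a' * 0 + b' * (-c / b) + c' = 0 := @hs (0, -c / b) (by simp; field_simp; ring)
    have h2 : a' * 1 + b' * (-c / b) + c' = 0 := @hs (1, -c / b) (by simp; field_simp; ring)
    refine ⟨b' / b, ?_, ?_, ?_⟩
    · linear_combination h2 - h1
    · field_simp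
    · field_simp at h1 ⊢; linear_combination h1

/-- Two equations of the same line are associated. -/
lemma associated_lin3 {a b c a' b' c' : K} (h : (a, b) ≠ (0, 0)) (h' : (a', b') ≠ (0, 0))
    (hs : {p : K × K | a * p.1 + b * p.2 + c = 0} = {p : K × K | a' * p.1 + b' * p.2 + c' = 0}) :
    Associated (lin3 a b c) (lin3 a' b' c') := by
  obtain ⟨k, hk⟩ := exists_lin3_eq_of_subset h hs.subset
  exact (prime_lin3 h).associated_of_dvd (prime_lin3 h') ⟨C k, by rw [hk]; ring⟩

lemma subset_of_lin3_dvd {a b c a' b' c' : K} (hd : lin3 a b c ∣ lin3 a' b' c') :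
    {p : K × K | a * p.1 + b * p.2 + c = 0} ⊆ {p : K × K | a' * p.1 + b' * p.2 + c' = 0} := by
  intro p hp
  obtain ⟨g, hg⟩ := hd
  have := congrArg (eval ![p.1, p.2, 1]) hg
  rw [map_mul, eval_lin3, eval_lin3] at this
  simp only [Set.mem_ofPred_eq] at hp ⊢
  rw [this, hp, zero_mul]

open Classical in
/-- A chosen homogenized equation of an affine line. -/
noncomputable def lineForm (L : Set (K × K)) : MvPolynomial (Fin 3) K :=
  if h : IsAffineLine L then lin3 h.choose h.choose_spec.choose h.choose_spec.choose_spec.choose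
  else 0

lemma exists_lineForm_eq {L : Set (K × K)} (h : IsAffineLine L) :
    ∃ a b c : K, (a, b) ≠ (0, 0) ∧ L = {p : K × K | a * p.1 + b * p.2 + c = 0} ∧
      lineForm L = lin3 a b c :=
  ⟨_, _, _, h.choose_spec.choose_spec.choose_spec.1, h.choose_spec.choose_spec.choose_spec.2,
    by rw [lineForm, dif_pos h]⟩

lemma prime_lineForm {L : Set (K × K)} (h : IsAffineLine L) : Prime (lineForm L) := by
  obtain ⟨a, b, c, h0, -, h2⟩ := exists_lineForm_eq h
  rw [h2]
  exact prime_lin3 h0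

lemma associated_lineForm {L : Set (K × K)} {a b c : K} (h : (a, b) ≠ (0, 0))
    (hL : L = {p : K × K | a * p.1 + b * p.2 + c = 0}) : Associated (lineForm L) (lin3 a b c) := by
  obtain ⟨a', b', c', h0, h1, h2⟩ := exists_lineForm_eq ⟨a, b, c, h, hL⟩
  rw [h2]
  exact associated_lin3 h0 h (h1.symm.trans hL)

lemma mem_line_iff {L : Set (K × K)} (h : IsAffineLine L) (p : K × K) :
    p ∈ L ↔ eval ![p.1, p.2, 1] (lineForm L) = 0 := by
  obtain ⟨a, b, c, -, h1, h2⟩ := exists_lineForm_eq h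
  rw [h2, eval_lin3, h1, Set.mem_ofPred_eq]

lemma isRelPrime_lineForm {L L' : Set (K × K)} (h : IsAffineLine L) (h' : IsAffineLine L')
    (hne : L ≠ L') : IsRelPrime (lineForm L) (lineForm L') := by
  rw [(prime_lineForm h).irreducible.isRelPrime_iff_not_dvd]
  intro hd
  have hd' := ((prime_lineForm h).associated_of_dvd (prime_lineForm h') hd).symm.dvd
  obtain ⟨a, b, c, -, h1, h2⟩ := exists_lineForm_eq h
  obtain ⟨a', b', c', -, h1', h2'⟩ := exists_lineForm_eq h'
  rw [h2, h2'] at hd hd'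
  exact hne (by rw [h1, h1']; exact (subset_of_lin3_dvd hd).antisymm (subset_of_lin3_dvd hd'))

lemma isHomogeneous_lineForm {L : Set (K × K)} (h : IsAffineLine L) :
    (lineForm L).IsHomogeneous 1 := by
  obtain ⟨a, b, c, -, -, h2⟩ := exists_lineForm_eq h
  rw [h2]
  exact isHomogeneous_lin3 a b c

/-- The product of the homogenized equations of the lines of `A`. -/
noncomputable def arrForm (A : Finset (Set (K × K))) : MvPolynomial (Fin 3) K :=
  ∏ L ∈ A, lineForm L

lemma arrForm_ne_zero {A : Finset (Set (K × K))} (hA : IsLineArr A) : arrForm A ≠ 0 :=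
  Finset.prod_ne_zero_iff.2 fun L hL => (prime_lineForm (hA L hL)).ne_zero

lemma isHomogeneous_arrForm {A : Finset (Set (K × K))} (hA : IsLineArr A) :
    (arrForm A).IsHomogeneous A.card := by
  have := IsHomogeneous.prod A lineForm (fun _ => 1) fun L hL => isHomogeneous_lineForm (hA L hL)
  simpa [arrForm] using this

lemma arrForm_dvd {A : Finset (Set (K × K))} (hA : IsLineArr A) {P : MvPolynomial (Fin 3) K}
    (h : ∀ L ∈ A, lineForm L ∣ P) : arrForm A ∣ P :=
  Finset.prod_dvd_of_isRelPrime
    (fun L hL L' hL' hne => isRelPrime_lineForm (hA L hL) (hA L' hL') hne) h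

/-- The derivation `f∂ₓ + g∂_y` is tangent to the cone over the line `L`. -/
def IsTangent (L : Set (K × K)) (f g : MvPolynomial (Fin 3) K) : Prop :=
  ∀ a b c : K, (a, b) ≠ (0, 0) → L = {p : K × K | a * p.1 + b * p.2 + c = 0} →
    lin3 a b c ∣ C a * f + C b * g

lemma IsTangent.dvd_det {L : Set (K × K)} (hL : IsAffineLine L)
    {f₁ g₁ f₂ g₂ : MvPolynomial (Fin 3) K} (h₁ : IsTangent L f₁ g₁) (h₂ : IsTangent L f₂ g₂) :
    lineForm L ∣ f₁ * g₂ - f₂ * g₁ := by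
  obtain ⟨a, b, c, h0, h1, h2⟩ := exists_lineForm_eq hL
  obtain ⟨u, hu⟩ := h₁ a b c h0 h1
  obtain ⟨v, hv⟩ := h₂ a b c h0 h1
  rw [h2]
  have key : ∀ k : K, k ≠ 0 → lin3 a b c ∣ C k * (f₁ * g₂ - f₂ * g₁) →
      lin3 a b c ∣ f₁ * g₂ - f₂ * g₁ := fun k hk h =>
    (IsUnit.dvd_mul_left ((isUnit_iff_ne_zero.2 hk).map C)).1 h
  rcases ne_or_eq a 0 with ha | rfl
  · exact key a ha ⟨u * g₂ - v * g₁, by linear_combination g₂ * hu - g₁ * hv⟩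
  · have hb : b ≠ 0 := fun hb => h0 (by simp [hb])
    exact key b hb ⟨f₁ * v - f₂ * u, by linear_combination f₁ * hv - f₂ * hu⟩

end LinearForms

section Saito

lemma applyDer3_lin3 (θ : Fin 3 → MvPolynomial (Fin 3) K) (a b c : K) :
    applyDer3 θ (lin3 a b c) = C a * θ 0 + C b * θ 1 + C c * θ 2 := by
  simp [applyDer3, lin3, Fin.sum_univ_three, pderiv_X, Pi.single_apply]
  ring

/-- **Saito's criterion** for cones over affine line arrangements. -/
lemma isFree_of_det {A : Finset (Set (K × K))} (hA : IsLineArr A)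
    {f₁ g₁ f₂ g₂ : MvPolynomial (Fin 3) K} {d₁ d₂ : ℕ}
    (hf₁ : f₁.IsHomogeneous d₁) (hg₁ : g₁.IsHomogeneous d₁)
    (hf₂ : f₂.IsHomogeneous d₂) (hg₂ : g₂.IsHomogeneous d₂)
    (h₁ : ∀ L ∈ A, IsTangent L f₁ g₁) (h₂ : ∀ L ∈ A, IsTangent L f₂ g₂)
    (hdet : f₁ * g₂ - f₂ * g₁ = arrForm A) : IsFree A := by
  have hQ := arrForm_ne_zero hA
  have mem : ∀ f g : MvPolynomial (Fin 3) K, (∀ L ∈ A, IsTangent L f g) →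
      InDCone A ![f, g, 0] := by
    intro f g h
    refine ⟨fun L hL a b c h0 h1 => ?_, 0, ?_⟩
    · obtain ⟨w, hw⟩ := h L hL a b c h0 h1
      exact ⟨w, by rw [applyDer3_lin3]; simp [hw, mul_comm w]⟩
    · simp [applyDer3, pderiv_X, Pi.single_apply]
  refine ⟨d₁, d₂, ![f₁, g₁, 0], ![f₂, g₂, 0], mem _ _ h₁, mem _ _ h₂, ?_, ?_, ?_⟩
  · intro i; fin_cases i
    exacts [hf₁, hg₁, isHomogeneous_zero _ _ _]
  · intro i; fin_cases i
    exacts [hf₂, hg₂, isHomogeneous_zero _ _ _]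
  intro θ ⟨hθ, e, he⟩
  have he2 : θ 2 = e * X 2 := by
    rw [← he]; simp [applyDer3, pderiv_X, Pi.single_apply]
  have ht : ∀ L ∈ A, IsTangent L (θ 0 - e * X 0) (θ 1 - e * X 1) := by
    intro L hL a b c h0 h1
    obtain ⟨w, hw⟩ := hθ L hL a b c h0 h1
    rw [applyDer3_lin3, he2] at hw
    refine ⟨w - e, ?_⟩
    simp only [lin3] at hw ⊢
    linear_combination hw
  obtain ⟨u, hu⟩ := arrForm_dvd hA fun L hL => (ht L hL).dvd_det (hA L hL) (h₂ L hL)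
  obtain ⟨v, hv⟩ := arrForm_dvd hA fun L hL => (h₁ L hL).dvd_det (hA L hL) (ht L hL)
  refine ⟨(e, u, v), ?_, ?_⟩
  · funext j
    fin_cases j
    · change θ 0 = e * X 0 + u * f₁ + v * f₂
      apply mul_left_cancel₀ hQ
      linear_combination (θ 0 - e * X 0) * (-hdet) + f₁ * hu + f₂ * hv
    · change θ 1 = e * X 1 + u * g₁ + v * g₂
      apply mul_left_cancel₀ hQ
      linear_combination (θ 1 - e * X 1) * (-hdet) + g₁ * hu + g₂ * hv
    · simp [he2]
  · rintro ⟨e', u', v'⟩ h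
    have h0 := congrFun h 0
    have h1 := congrFun h 1
    have h2 := congrFun h 2
    simp at h0 h1 h2
    have hee : e' = e := by
      apply mul_right_cancel₀ (X_ne_zero (R := K) (2 : Fin 3))
      rw [← h2, he2]
    subst hee
    have hu' : u' = u := by
      apply mul_left_cancel₀ hQ
      linear_combination hu - g₂ * h0 + f₂ * h1 - u' * hdet
    have hv' : v' = v := by
      apply mul_left_cancel₀ hQ
      linear_combination hv + g₁ * h0 - f₁ * h1 - v' * hdet
    rw [hu', hv']

end Saito

section Homogeneous

lemma homogeneousComponent_mul_of_isHomogeneous_s19 {n m : ℕ} (f : MvPolynomial (Fin 3) K)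
    {F : MvPolynomial (Fin 3) K} (hF : F.IsHomogeneous m) :
    homogeneousComponent (n + m) (f * F) = homogeneousComponent n f * F := by
  conv_lhs => rw [← sum_homogeneousComponent f, Finset.sum_mul, map_sum]
  have : ∀ i, homogeneousComponent (n + m) (homogeneousComponent i f * F) =
      if n = i then homogeneousComponent i f * F else 0 := fun i => by
    rw [homogeneousComponent_of_mem ((homogeneousComponent_isHomogeneous i f).mul hF)]
    simp
  simp only [this, Finset.sum_ite_eq, Finset.mem_range]
  split_ifs with h
  · rfl
  · rw [homogeneousComponent_eq_zero _ _ (by omega), zero_mul]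

lemma isHomogeneous_of_mul {d m : ℕ} {f F : MvPolynomial (Fin 3) K} (hF : F.IsHomogeneous m)
    (h0 : F ≠ 0) (h : (F * f).IsHomogeneous d) : f.IsHomogeneous (d - m) := by
  rcases eq_or_ne f 0 with rfl | hf
  · exact isHomogeneous_zero _ _ _
  have hd : m ≤ d := by
    rw [← h.totalDegree (mul_ne_zero h0 hf), totalDegree_mul_of_isDomain h0 hf, hF.totalDegree h0]
    omega
  have h1 := homogeneousComponent_mul_of_isHomogeneous_s19 (n := d - m) f hF
  rw [Nat.sub_add_cancel hd, mul_comm f, homogeneousComponent_of_mem h, if_pos rfl,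
    mul_comm F] at h1
  rw [mul_right_cancel₀ h0 h1]
  exact homogeneousComponent_isHomogeneous _ _

end Homogeneous

section FiniteField

variable [Fintype K]

lemma prod_X_sub_C_univ (K : Type*) [Field K] [Fintype K] :
    ∏ a : K, (Polynomial.X - Polynomial.C a) =
    (Polynomial.X ^ Fintype.card K - Polynomial.X : Polynomial K) := by
  have hr := FiniteField.roots_X_pow_card_sub_X K
  have hm : (Polynomial.X ^ Fintype.card K - Polynomial.X : Polynomial K).Monic :=
    Polynomial.monic_X_pow_sub (by simpa using Fintype.one_lt_card (α := K))
  have := Polynomial.prod_multiset_X_sub_C_of_monic_of_roots_card_eq hm (by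
    rw [hr, FiniteField.X_pow_card_sub_X_natDegree_eq K Fintype.one_lt_card]; rfl)
  rw [hr] at this
  exact this

lemma prod_sub_mul_eq {E : Type*} [Field E] [Algebra K E] (x z : E) (hz : z ≠ 0) :
    ∏ a : K, (x - algebraMap K E a * z) =
      x ^ Fintype.card K - x * z ^ (Fintype.card K - 1) := by
  have hq : 0 < Fintype.card K := Fintype.card_pos
  have h := congrArg (Polynomial.aeval (x / z)) (prod_X_sub_C_univ K)
  simp only [map_prod, map_sub, map_pow, Polynomial.aeval_X, Polynomial.aeval_C] at h
  calc ∏ a : K, (x - algebraMap K E a * z) = ∏ a : K, (z * (x / z - algebraMap K E a)) := by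
        refine Finset.prod_congr rfl fun a _ => ?_
        field_simp
    _ = z ^ Fintype.card K * ((x / z) ^ Fintype.card K - x / z) := by
        rw [Finset.prod_mul_distrib, h, Finset.prod_const, Finset.card_univ]
    _ = _ := by
        obtain ⟨n, hn⟩ : ∃ n, Fintype.card K = n + 1 := ⟨_, (Nat.sub_add_cancel hq).symm⟩
        rw [hn, Nat.add_sub_cancel, mul_sub, ← mul_pow, mul_div_cancel₀ _ hz, pow_succ z]
        field_simp

/-- The homogenization of `x_i ^ q - x_i`, in product form. -/
noncomputable def frobForm (K : Type*) [Field K] [Fintype K] (i : Fin 3) :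
    MvPolynomial (Fin 3) K :=
  ∏ a : K, (X i - C a * X 2)

lemma frobForm_eq (i : Fin 3) :
    frobForm K i = X i ^ Fintype.card K - X i * X 2 ^ (Fintype.card K - 1) := by
  apply IsFractionRing.injective (MvPolynomial (Fin 3) K) (FractionRing (MvPolynomial (Fin 3) K))
  have h := prod_sub_mul_eq (K := K) (E := FractionRing (MvPolynomial (Fin 3) K))
    (algebraMap (MvPolynomial (Fin 3) K) _ (X i)) (algebraMap (MvPolynomial (Fin 3) K) _ (X 2)) (by
      rw [Ne, map_eq_zero_iff _ (IsFractionRing.injective _ _)]; exact X_ne_zero _)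
  simp only [frobForm, map_prod, map_sub, map_mul, map_pow]
  rw [← h]
  rfl

lemma isHomogeneous_frobForm (i : Fin 3) :
    (frobForm K i).IsHomogeneous (Fintype.card K) := by
  have := IsHomogeneous.prod (Finset.univ : Finset K)
    (fun a => (X i - C a * X 2 : MvPolynomial (Fin 3) K)) (fun _ => 1)
    fun a _ => (isHomogeneous_X K i).sub (isHomogeneous_C_mul_X a 2)
  simpa [frobForm] using this

lemma lin3_dvd_frobForm (a b c : K) :
    lin3 a b c ∣ C a * frobForm K 0 + C b * frobForm K 1 := by
  have hq : 0 < Fintype.card K := Fintype.card_pos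
  obtain ⟨p, hp⟩ := CharP.exists K
  obtain ⟨n, hpr, hn⟩ := FiniteField.card K p
  have : Fact p.Prime := ⟨hpr⟩
  have hC : ∀ k : K, (C k : MvPolynomial (Fin 3) K) ^ Fintype.card K = C k := fun k => by
    rw [← C_pow, FiniteField.pow_card]
  have hadd : ∀ x y : MvPolynomial (Fin 3) K,
      (x + y) ^ Fintype.card K = x ^ Fintype.card K + y ^ Fintype.card K := fun x y => by
    rw [hn]; exact add_pow_expChar_pow x y p n
  have h2 : (X 2 : MvPolynomial (Fin 3) K) ^ Fintype.card K = X 2 * X 2 ^ (Fintype.card K - 1) := by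
    rw [← pow_succ', Nat.sub_add_cancel hq]
  have key : C a * frobForm K 0 + C b * frobForm K 1 =
      lin3 a b c ^ Fintype.card K - lin3 a b c * X 2 ^ (Fintype.card K - 1) := by
    rw [lin3, hadd, hadd, mul_pow, mul_pow, mul_pow, hC, hC, hC, frobForm_eq, frobForm_eq, h2]
    ring
  rw [key]
  exact dvd_sub (dvd_pow_self _ hq.ne') (dvd_mul_right _ _)

lemma isTangent_frobForm (L : Set (K × K)) : IsTangent L (frobForm K 0) (frobForm K 1) :=
  fun a b c _ _ => lin3_dvd_frobForm a b c

lemma eval_frobForm (i : Fin 3) (p : Fin 3 → K) (hp : p 2 = 1) : eval p (frobForm K i) = 0 := by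
  simp [frobForm_eq, hp, FiniteField.pow_card]

/-- A product of affine lines covering `K²` lies in the ideal generated by the two
homogenized field equations. -/
lemma exists_eq_frobForm {A : Finset (Set (K × K))} (hA : IsLineArr A)
    (hcov : ∀ p : K × K, ∃ L ∈ A, p ∈ L) :
    ∃ f g : MvPolynomial (Fin 3) K, arrForm A = f * frobForm K 1 - frobForm K 0 * g := by
  classical
  let φ : MvPolynomial (Fin 3) K →ₐ[K] MvPolynomial (Fin 2) (Polynomial K) :=
    aeval ![X 0, X 1, C Polynomial.X]
  let ψ : MvPolynomial (Fin 2) (Polynomial K) →+* MvPolynomial (Fin 3) K :=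
    eval₂Hom (Polynomial.aeval (X 2 : MvPolynomial (Fin 3) K)).toRingHom ![X 0, X 1]
  have hψφ : ∀ P, ψ (φ P) = P := by
    have : ψ.comp φ.toRingHom = RingHom.id _ := by
      ext i
      · simp [φ, ψ]
      · fin_cases i <;> simp [φ, ψ]
    exact fun P => congrArg (fun h => h P) this
  let S : Fin 2 → Finset (Polynomial K) := fun _ =>
    Finset.univ.image fun a : K => Polynomial.C a * Polynomial.X
  have hinj : Function.Injective fun a : K => Polynomial.C a * Polynomial.X := by
    intro a b h
    simpa using h
  have hS : ∀ i, ψ (∏ s ∈ S i, (X i - C s)) = frobForm K i.castSucc := by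
    intro i
    simp only [S, frobForm]
    rw [Finset.prod_image hinj.injOn, map_prod]
    refine Finset.prod_congr rfl fun a _ => ?_
    fin_cases i <;> simp [ψ, algebraMap_eq]
  obtain ⟨h, -, hh⟩ := combinatorial_nullstellensatz_exists_linearCombination S
    (fun i => Finset.univ_nonempty.image _) (φ (arrForm A)) (by
      intro x hx
      obtain ⟨a, -, ha⟩ := Finset.mem_image.1 (hx 0)
      obtain ⟨b, -, hb⟩ := Finset.mem_image.1 (hx 1)
      obtain ⟨L, hL, hp⟩ := hcov (a, b)
      obtain ⟨u, v, w, h0, h1, h2⟩ := exists_lineForm_eq (hA L hL)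
      rw [arrForm, map_prod, map_prod]
      refine Finset.prod_eq_zero hL ?_
      rw [h1] at hp
      simp only [Set.mem_ofPred_eq] at hp
      have := congrArg (fun k => Polynomial.C k * Polynomial.X) hp
      simp [h2, lin3, φ, ← ha, ← hb] at this ⊢
      linear_combination Polynomial.X * this)
  have hfin := congrArg ψ hh
  rw [hψφ, Finsupp.linearCombination_apply, Finsupp.sum_fintype _ _ (by simp),
    Fin.sum_univ_two, map_add, smul_eq_mul, smul_eq_mul, map_mul, map_mul, hS, hS] at hfin
  refine ⟨ψ (h 1), -ψ (h 0), hfin.trans ?_⟩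
  simp
  ring

lemma not_lin3_dvd_frobForm_one {a b c : K} (ha : a ≠ 0) : ¬ lin3 a b c ∣ frobForm K 1 := by
  intro h
  have hp := prime_lin3 (a := a) (b := b) (c := c) (by simp [ha])
  obtain ⟨k, -, hk⟩ := (Prime.dvd_finsetProd_iff hp _).1 h
  have hk' : lin3 a b c ∣ lin3 0 1 (-k) := by convert hk using 1; simp [lin3]; ring
  have h1 := @subset_of_lin3_dvd K _ _ _ _ _ _ _ hk' (-(b * (k + 1) + c) / a, k + 1) (by
    simp; field_simp; ring)
  simp at h1

lemma not_lin3_dvd_frobForm_zero {a b c : K} (hb : b ≠ 0) : ¬ lin3 a b c ∣ frobForm K 0 := by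
  intro h
  have hp := prime_lin3 (a := a) (b := b) (c := c) (by simp [hb])
  obtain ⟨k, -, hk⟩ := (Prime.dvd_finsetProd_iff hp _).1 h
  have hk' : lin3 a b c ∣ lin3 1 0 (-k) := by convert hk using 1; simp [lin3]; ring
  have h1 := @subset_of_lin3_dvd K _ _ _ _ _ _ _ hk' (k + 1, -(a * (k + 1) + c) / b) (by
    simp; field_simp; ring)
  simp at h1

/-- Arrangements covering `K²` are free, with one exponent equal to `q`. -/
lemma exists_pair_of_covering {A : Finset (Set (K × K))} (hA : IsLineArr A) {d : ℕ}
    (hd : A.card = d + Fintype.card K) (hcov : ∀ p : K × K, ∃ L ∈ A, p ∈ L) :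
    ∃ f g : MvPolynomial (Fin 3) K, f.IsHomogeneous d ∧ g.IsHomogeneous d ∧
      (∀ L ∈ A, IsTangent L f g) ∧ f * frobForm K 1 - frobForm K 0 * g = arrForm A := by
  obtain ⟨f, g, hfg⟩ := exists_eq_frobForm hA hcov
  have hfg' := congrArg (homogeneousComponent (d + Fintype.card K)) hfg
  rw [homogeneousComponent_of_mem (isHomogeneous_arrForm hA), if_pos hd.symm, map_sub,
    mul_comm _ g, homogeneousComponent_mul_of_isHomogeneous_s19 _ (isHomogeneous_frobForm 1),
    homogeneousComponent_mul_of_isHomogeneous_s19 _ (isHomogeneous_frobForm 0)] at hfg'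
  refine ⟨homogeneousComponent d f, homogeneousComponent d g,
    homogeneousComponent_isHomogeneous _ _, homogeneousComponent_isHomogeneous _ _, ?_, ?_⟩
  · intro L hL a b c h0 h1
    have hdvd : lin3 a b c ∣ arrForm A :=
      (associated_lineForm h0 h1).symm.dvd.trans (Finset.dvd_prod_of_mem _ hL)
    obtain ⟨u, hu⟩ := hdvd
    obtain ⟨v, hv⟩ := lin3_dvd_frobForm a b c
    rcases ne_or_eq a 0 with ha | rfl
    · refine ((prime_lin3 h0).dvd_or_dvd (b := frobForm K 1) ⟨C a * u +
        homogeneousComponent d g * v, ?_⟩).resolve_right (not_lin3_dvd_frobForm_one ha)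
      linear_combination C a * hu - C a * hfg' + homogeneousComponent d g * hv
    · have hb : b ≠ 0 := fun hb => h0 (by simp [hb])
      refine ((prime_lin3 h0).dvd_or_dvd (b := frobForm K 0) ⟨-C b * u +
        homogeneousComponent d f * v, ?_⟩).resolve_right (not_lin3_dvd_frobForm_zero hb)
      linear_combination -C b * hu + C b * hfg' + homogeneousComponent d f * hv
  · rw [hfg']; ring

end FiniteField

section Restriction

lemma aeval_mul_of_isHomogeneous {E : Type*} [CommRing E] [Algebra K E]
    {f : MvPolynomial (Fin 3) K} {d : ℕ} (hf : f.IsHomogeneous d) (z : E) (v : Fin 3 → E) :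
    aeval (fun i => z * v i) f = z ^ d * aeval v f := by
  simp only [aeval_def, eval₂_eq, Finset.mul_sum]
  refine Finset.sum_congr rfl fun s hs => ?_
  rw [hf.degree_eq_sum_deg_support hs]
  simp only [mul_pow, Finset.prod_mul_distrib, Finset.prod_pow_eq_pow_sum]
  ring

/-- Restriction to the affine line `y = m x + c`, parametrized by `x`. -/
noncomputable def restr (m c : K) : MvPolynomial (Fin 3) K →ₐ[K] Polynomial K :=
  aeval ![Polynomial.X, Polynomial.C m * Polynomial.X + Polynomial.C c, 1]

lemma eval_restr (m c t : K) (f : MvPolynomial (Fin 3) K) :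
    (restr m c f).eval t = eval ![t, m * t + c, 1] f := by
  have : ((Polynomial.evalRingHom t).comp (restr m c).toRingHom) =
      eval ![t, m * t + c, 1] := by
    ext i
    · simp [restr]
    · fin_cases i <;> simp [restr]
  exact congrArg (fun h => h f) this

lemma natDegree_restr_le (m c : K) {f : MvPolynomial (Fin 3) K} {d : ℕ} (hf : f.IsHomogeneous d) :
    (restr m c f).natDegree ≤ d := by
  have := aeval_natDegree_le f hf.totalDegree_le
    ![Polynomial.X, Polynomial.C m * Polynomial.X + Polynomial.C c, 1] (n := 1) (by
      intro i
      fin_cases i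
      · simp
      · exact Polynomial.natDegree_linear_le
      · simp)
  simpa [restr] using this

lemma lin3_dvd_of_restr_eq_zero {m c : K} {f : MvPolynomial (Fin 3) K} {d : ℕ}
    (hf : f.IsHomogeneous d) (h : restr m c f = 0) : lin3 m (-1) c ∣ f := by
  let σ : MvPolynomial (Fin 3) K →ₐ[K] MvPolynomial (Fin 3) K :=
    aeval ![X 0, C m * X 0 + C c * X 2, X 2]
  have hσ : lin3 m (-1) c ∣ f - σ f := by
    rw [← Ideal.mem_span_singleton, ← Ideal.Quotient.mk_eq_mk_iff_sub_mem]
    have : (Ideal.Quotient.mkₐ K (Ideal.span {lin3 m (-1) c})).comp σ =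
        Ideal.Quotient.mkₐ K (Ideal.span {lin3 m (-1) c}) := by
      ext i
      fin_cases i
      · simp [σ]
      · simp only [σ, AlgHom.comp_apply, aeval_X]
        refine Ideal.Quotient.eq.2 (Ideal.mem_span_singleton.2 ⟨1, ?_⟩)
        simp [lin3]
        ring
      · simp [σ]
    exact (congrArg (fun h => h f) this).symm
  have hσ0 : σ f = 0 := by
    let E := FractionRing (MvPolynomial (Fin 3) K)
    obtain ⟨ι, hι⟩ : ∃ ι : MvPolynomial (Fin 3) K →ₐ[K] E, Function.Injective ι :=
      ⟨IsScalarTower.toAlgHom K (MvPolynomial (Fin 3) K) E,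
        IsFractionRing.injective (MvPolynomial (Fin 3) K) E⟩
    have hz : ι (X 2) ≠ 0 := (map_ne_zero_iff ι hι).2 (X_ne_zero _)
    apply hι
    have h1 : ι.comp σ = aeval (fun i => ι (X 2) * (![ι (X 0) / ι (X 2),
        algebraMap K E m * (ι (X 0) / ι (X 2)) + algebraMap K E c, 1] : Fin 3 → E) i) := by
      have hC : ∀ k : K, ι (C k) = algebraMap K E k := fun k => ι.commutes k
      ext i
      fin_cases i
      · simp [σ, mul_div_cancel₀ _ hz]
      · simp [σ, hC, mul_comm (ι (X 2)), add_mul, mul_assoc, div_mul_cancel₀ _ hz]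
      · simp [σ]
    have h2 : (Polynomial.aeval (ι (X 0) / ι (X 2))).comp (restr m c) =
        aeval (![ι (X 0) / ι (X 2),
        algebraMap K E m * (ι (X 0) / ι (X 2)) + algebraMap K E c, 1] : Fin 3 → E) := by
      ext i
      fin_cases i <;> simp [restr]
    rw [← AlgHom.comp_apply, h1, aeval_mul_of_isHomogeneous hf, ← h2, AlgHom.comp_apply, h]
    simp
  rwa [hσ0, sub_zero] at hσ

/-- The set of points of the affine line `y = m x + c`. -/
def slopeLine (m c : K) : Set (K × K) := {p : K × K | m * p.1 + -1 * p.2 + c = 0}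

lemma isAffineLine_slopeLine (m c : K) : IsAffineLine (slopeLine m c) :=
  ⟨m, -1, c, by simp, rfl⟩

lemma mem_slopeLine {m c : K} {p : K × K} : p ∈ slopeLine m c ↔ p.2 = m * p.1 + c := by
  rw [slopeLine, Set.mem_ofPred_eq]
  constructor <;> intro h <;> linear_combination -h

lemma lineForm_slopeLine_dvd {m c : K} {f : MvPolynomial (Fin 3) K} :
    lineForm (slopeLine m c) ∣ f ↔ lin3 m (-1) c ∣ f :=
  (associated_lineForm (by simp) rfl).dvd_iff_dvd_left

lemma eval_eq_zero_of_isTangent {m c t : K} {L : Set (K × K)} (hL : IsAffineLine L)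
    (hne : L ≠ slopeLine m c) (hmem : (t, m * t + c) ∈ L) {f g : MvPolynomial (Fin 3) K}
    (h : IsTangent L f g) (h' : IsTangent (slopeLine m c) f g) :
    eval ![t, m * t + c, 1] f = 0 := by
  obtain ⟨a, b, e, h0, h1, -⟩ := exists_lineForm_eq hL
  have hp : a * t + b * (m * t + c) + e = 0 := by rw [h1] at hmem; exact hmem
  obtain ⟨u, hu⟩ := h a b e h0 h1
  obtain ⟨v, hv⟩ := h' m (-1) c (by simp) rfl
  have hu' := congrArg (eval ![t, m * t + c, 1]) hu
  have hv' := congrArg (eval ![t, m * t + c, 1]) hv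
  simp only [map_add, map_mul, eval_C] at hu' hv'
  rw [show eval ![t, m * t + c, 1] (lin3 a b e) = 0 by
    simpa using (eval_lin3 a b e (t, m * t + c)).trans hp] at hu'
  rw [show eval ![t, m * t + c, 1] (lin3 m (-1) c) = 0 by
    simpa using eval_lin3 m (-1) c (t, m * t + c)] at hv'
  have hab : a + b * m ≠ 0 := by
    intro hab
    have hb : b ≠ 0 := by
      rintro rfl
      exact h0 (by simpa using hab)
    apply hne
    ext p
    rw [h1, mem_slopeLine, Set.mem_ofPred_eq]
    constructor <;> intro hh
    · apply mul_left_cancel₀ hb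
      linear_combination hh - hp - (p.1 - t) * hab
    · linear_combination b * hh + hp + (p.1 - t) * hab
  refine (mul_eq_zero.1 ?_).resolve_left hab
  linear_combination hu' + b * hv'

variable {A : Finset (Set (K × K))} {m c : K}

lemma arrForm_insert [DecidableEq (Set (K × K))] {H : Set (K × K)} (hH : H ∉ A) :
    arrForm (insert H A) = lineForm H * arrForm A :=
  Finset.prod_insert hH

/-- A derivation tangent to all lines of `A` which vanishes on a further line can be divided
by the equation of that line. -/
lemma exists_div_lineForm (hA : IsLineArr A) {f g : MvPolynomial (Fin 3) K} {d : ℕ}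
    (hH : slopeLine m c ∉ A) (hf : f.IsHomogeneous d) (hg : g.IsHomogeneous d)
    (hT : ∀ L ∈ A, IsTangent L f g) (hTH : IsTangent (slopeLine m c) f g)
    (hr : restr m c f = 0) :
    ∃ f' g', f = lineForm (slopeLine m c) * f' ∧ g = lineForm (slopeLine m c) * g' ∧
      f'.IsHomogeneous (d - 1) ∧ g'.IsHomogeneous (d - 1) ∧ ∀ L ∈ A, IsTangent L f' g' := by
  have hprime := prime_lineForm (isAffineLine_slopeLine m c)
  have hhom := isHomogeneous_lineForm (isAffineLine_slopeLine m c)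
  have hdf := lin3_dvd_of_restr_eq_zero hf hr
  obtain ⟨u, hu⟩ := hTH m (-1) c (by simp) rfl
  have hdg : lin3 m (-1) c ∣ g := by
    obtain ⟨v, hv⟩ := hdf
    refine ⟨C m * v - u, ?_⟩
    simp only [map_neg, map_one] at hu
    linear_combination C m * hv - hu
  obtain ⟨f', rfl⟩ := lineForm_slopeLine_dvd.2 hdf
  obtain ⟨g', rfl⟩ := lineForm_slopeLine_dvd.2 hdg
  refine ⟨f', g', rfl, rfl, isHomogeneous_of_mul hhom hprime.ne_zero hf,
    isHomogeneous_of_mul hhom hprime.ne_zero hg, fun L hL a b e h0 h1 => ?_⟩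
  have hassoc := associated_lineForm h0 h1
  obtain ⟨w, hw⟩ := hT L hL a b e h0 h1
  refine ((prime_lin3 h0).dvd_or_dvd (a := lineForm (slopeLine m c)) ⟨w, ?_⟩).resolve_left ?_
  · linear_combination hw
  · intro hd
    refine ((prime_lineForm (hA L hL)).irreducible.isRelPrime_iff_not_dvd).1
      (isRelPrime_lineForm (hA L hL) (isAffineLine_slopeLine m c) ?_) (hassoc.dvd.trans hd)
    rintro rfl
    exact hH hL

end Restriction

section Deletion

lemma IsTangent.sub_mul {L : Set (K × K)} {f₁ g₁ f₂ g₂ : MvPolynomial (Fin 3) K}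
    (h₁ : IsTangent L f₁ g₁) (h₂ : IsTangent L f₂ g₂) (k : MvPolynomial (Fin 3) K) :
    IsTangent L (f₂ - k * f₁) (g₂ - k * g₁) := by
  intro a b c h0 h1
  obtain ⟨u, hu⟩ := h₁ a b c h0 h1
  obtain ⟨v, hv⟩ := h₂ a b c h0 h1
  exact ⟨v - k * u, by linear_combination hv - k * hu⟩

variable [Fintype K] {A : Finset (Set (K × K))} {m c s : K}

open Classical in
/-- The monic polynomial with simple roots at all elements of `K` other than `s`. -/
noncomputable def punctured (s : K) : Polynomial K :=
  ∏ t ∈ Finset.univ.erase s, (Polynomial.X - Polynomial.C t)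

lemma monic_punctured (s : K) : (punctured s).Monic :=
  Polynomial.monic_prod_of_monic _ _ fun t _ => Polynomial.monic_X_sub_C t

lemma natDegree_punctured (s : K) : (punctured s).natDegree = Fintype.card K - 1 := by
  classical
  rw [punctured, Polynomial.natDegree_prod_of_monic _ _ fun t _ => Polynomial.monic_X_sub_C t]
  simp [Finset.card_univ]

lemma restr_frobForm_zero (m c s : K) :
    restr m c (frobForm K 0) = (Polynomial.X - Polynomial.C s) * punctured s := by
  classical
  rw [punctured, Finset.mul_prod_erase _ (fun t => Polynomial.X - Polynomial.C t)
    (Finset.mem_univ s), frobForm, map_prod]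
  refine Finset.prod_congr rfl fun a _ => ?_
  simp [restr]

lemma restr_eq_of_eval_eq_zero {f : MvPolynomial (Fin 3) K} {d : ℕ} (hf : f.IsHomogeneous d)
    (hd : d ≤ Fintype.card K - 1) (h : ∀ t ≠ s, eval ![t, m * t + c, 1] f = 0) :
    ∃ k, restr m c f = Polynomial.C k * punctured s := by
  classical
  refine ⟨_, Polynomial.eq_leadingCoeff_mul_of_monic_of_dvd_of_natDegree_le (monic_punctured s)
    ?_ ((natDegree_restr_le m c hf).trans (hd.trans (natDegree_punctured s).ge))⟩
  refine Finset.prod_dvd_of_coprime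
    (fun a _ b _ hab => Polynomial.pairwise_coprime_X_sub_C (s := id) Function.injective_id hab)
    fun t ht => ?_
  rw [Polynomial.dvd_iff_isRoot, Polynomial.IsRoot, eval_restr]
  exact h t (Finset.ne_of_mem_erase ht)

/-- `A` admits a basis of two derivations of degrees at most `q - 1`. -/
def HasSmallBasis (A : Finset (Set (K × K))) : Prop :=
  ∃ (f₁ g₁ f₂ g₂ : MvPolynomial (Fin 3) K) (d₁ d₂ : ℕ),
    f₁.IsHomogeneous d₁ ∧ g₁.IsHomogeneous d₁ ∧ f₂.IsHomogeneous d₂ ∧ g₂.IsHomogeneous d₂ ∧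
    d₁ ≤ Fintype.card K - 1 ∧ d₂ ≤ Fintype.card K - 1 ∧
    (∀ L ∈ A, IsTangent L f₁ g₁) ∧ (∀ L ∈ A, IsTangent L f₂ g₂) ∧
    f₁ * g₂ - f₂ * g₁ = arrForm A

open Classical in
lemma HasSmallBasis.of_insert (hA : IsLineArr A) (hH : slopeLine m c ∉ A)
    (hcov : ∀ t ≠ s, ∃ L ∈ A, (t, m * t + c) ∈ L)
    (h : HasSmallBasis (insert (slopeLine m c) A)) : HasSmallBasis A := by
  obtain ⟨f₁, g₁, f₂, g₂, d₁, d₂, hf₁, hg₁, hf₂, hg₂, hd₁, hd₂, hT₁, hT₂, hdet⟩ := h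
  rw [arrForm_insert hH] at hdet
  simp only [Finset.forall_mem_insert] at hT₁ hT₂
  have hα := (prime_lineForm (isAffineLine_slopeLine m c)).ne_zero
  have hvan : ∀ f g, (IsTangent (slopeLine m c) f g ∧ ∀ L ∈ A, IsTangent L f g) →
      ∀ t ≠ s, eval ![t, m * t + c, 1] f = 0 := fun f g hfg t ht => by
    obtain ⟨L, hL, hp⟩ := hcov t ht
    exact eval_eq_zero_of_isTangent (hA L hL) (fun he => hH (he ▸ hL)) hp (hfg.2 L hL) hfg.1
  obtain ⟨k₁, hk₁⟩ := restr_eq_of_eval_eq_zero hf₁ hd₁ (hvan f₁ g₁ hT₁)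
  obtain ⟨k₂, hk₂⟩ := restr_eq_of_eval_eq_zero hf₂ hd₂ (hvan f₂ g₂ hT₂)
  rcases eq_or_ne k₁ 0 with rfl | hk₁0
  · obtain ⟨f', g', rfl, rfl, hf', hg', hT'⟩ :=
      exists_div_lineForm hA hH hf₁ hg₁ hT₁.2 hT₁.1 (by simp [hk₁])
    refine ⟨f', g', f₂, g₂, _, _, hf', hg', hf₂, hg₂, by omega, hd₂, hT', hT₂.2, ?_⟩
    apply mul_left_cancel₀ hα
    linear_combination hdet
  have hdeg : ∀ {f : MvPolynomial (Fin 3) K} {d : ℕ} {k : K}, f.IsHomogeneous d →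
      d ≤ Fintype.card K - 1 → restr m c f = Polynomial.C k * punctured s → k ≠ 0 →
      d = Fintype.card K - 1 := fun {f d k} hf hd hr hk => by
    refine hd.antisymm ?_
    rw [← natDegree_punctured s, ← Polynomial.natDegree_C_mul hk, ← hr]
    exact natDegree_restr_le m c hf
  suffices ∃ k : K, restr m c (f₂ - C k * f₁) = 0 ∧ (f₂ - C k * f₁).IsHomogeneous d₂ ∧
      (g₂ - C k * g₁).IsHomogeneous d₂ by
    obtain ⟨k, hr, hf, hg⟩ := this
    obtain ⟨f', g', hf'e, hg'e, hf', hg', hT'⟩ := exists_div_lineForm hA hH hf hg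
      (fun L hL => (hT₁.2 L hL).sub_mul (hT₂.2 L hL) _) (hT₁.1.sub_mul hT₂.1 _) hr
    refine ⟨f₁, g₁, f', g', _, _, hf₁, hg₁, hf', hg', hd₁, by omega, hT₁.2, hT', ?_⟩
    apply mul_left_cancel₀ hα
    linear_combination hdet - f₁ * hg'e + g₁ * hf'e
  rcases eq_or_ne k₂ 0 with rfl | hk₂0
  · exact ⟨0, by simp [hk₂], by simpa using hf₂, by simpa using hg₂⟩
  · have h1 := hdeg hf₁ hd₁ hk₁ hk₁0
    have h2 := hdeg hf₂ hd₂ hk₂ hk₂0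
    subst h1 h2
    refine ⟨k₂ / k₁, ?_, hf₂.sub (hf₁.C_mul _), hg₂.sub (hg₁.C_mul _)⟩
    rw [map_sub, map_mul, hk₁, hk₂, ← algebraMap_eq, AlgHom.commutes, ← mul_assoc,
      Polynomial.algebraMap_eq, ← Polynomial.C_mul, div_mul_cancel₀ _ hk₁0, sub_self]

open Classical in
lemma HasSmallBasis.of_insert_covering (hA : IsLineArr A) (hH : slopeLine m c ∉ A)
    (hcard : A.card + 2 = 2 * Fintype.card K)
    (hcov : ∀ p : K × K, ∃ L ∈ insert (slopeLine m c) A, p ∈ L)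
    (hcovH : ∀ t ≠ s, ∃ L ∈ A, (t, m * t + c) ∈ L)
    (hs : ∀ L ∈ A, (s, m * s + c) ∉ L) : HasSmallBasis A := by
  have hq : 1 < Fintype.card K := Fintype.one_lt_card
  have hB : IsLineArr (insert (slopeLine m c) A) := by
    intro L hL
    rcases Finset.mem_insert.1 hL with rfl | hL
    exacts [isAffineLine_slopeLine m c, hA L hL]
  obtain ⟨f, g, hf, hg, hT, hdet⟩ := exists_pair_of_covering hB (d := Fintype.card K - 1)
    (by rw [Finset.card_insert_of_notMem hH]; omega) hcov
  rw [arrForm_insert hH] at hdet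
  simp only [Finset.forall_mem_insert] at hT
  have hα := (prime_lineForm (isAffineLine_slopeLine m c)).ne_zero
  obtain ⟨k, hk⟩ := restr_eq_of_eval_eq_zero (m := m) (c := c) (s := s) hf le_rfl fun t ht => by
    obtain ⟨L, hL, hp⟩ := hcovH t ht
    exact eval_eq_zero_of_isTangent (hA L hL) (fun he => hH (he ▸ hL)) hp (hT.2 L hL) hT.1
  have hk0 : k ≠ 0 := by
    rintro rfl
    obtain ⟨f', g', rfl, rfl, -, -, -⟩ :=
      exists_div_lineForm hA hH hf hg hT.2 hT.1 (by simp [hk])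
    have h1 : f' * frobForm K 1 - frobForm K 0 * g' = arrForm A := by
      apply mul_left_cancel₀ hα
      linear_combination hdet
    have h2 := congrArg (eval ![s, m * s + c, 1]) h1
    simp only [map_sub, map_mul, eval_frobForm _ ![s, m * s + c, 1] rfl] at h2
    rw [arrForm, map_prod, eq_comm, mul_zero, zero_mul, sub_zero, Finset.prod_eq_zero_iff] at h2
    obtain ⟨L, hL, h0⟩ := h2
    exact hs L hL ((mem_line_iff (hA L hL) _).2 h0)
  have hlin : (C k⁻¹ * (X 0 - C s * X 2) : MvPolynomial (Fin 3) K).IsHomogeneous 1 :=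
    ((isHomogeneous_X K 0).sub (isHomogeneous_C_mul_X s 2)).C_mul _
  have hhom : ∀ {P Q : MvPolynomial (Fin 3) K}, P.IsHomogeneous (Fintype.card K - 1) →
      Q.IsHomogeneous (Fintype.card K) →
      (Q - C k⁻¹ * (X 0 - C s * X 2) * P).IsHomogeneous (Fintype.card K) := fun hP hQ => by
    have := hlin.mul hP
    rw [Nat.add_sub_cancel' hq.le] at this
    exact hQ.sub this
  obtain ⟨f', g', hf'e, hg'e, hf', hg', hT'⟩ := exists_div_lineForm hA hH
    (hhom hf (isHomogeneous_frobForm 0)) (hhom hg (isHomogeneous_frobForm 1))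
    (fun L hL => (hT.2 L hL).sub_mul (isTangent_frobForm L) _)
    (hT.1.sub_mul (isTangent_frobForm _) _) (by
      rw [map_sub, map_mul, hk, restr_frobForm_zero m c s]
      have : Polynomial.C k⁻¹ * Polynomial.C k = (1 : Polynomial K) := by
        rw [← Polynomial.C_mul, inv_mul_cancel₀ hk0, Polynomial.C_1]
      simp [restr, -map_inv₀]
      linear_combination -(Polynomial.X - Polynomial.C s) * punctured s * this)
  refine ⟨f, g, f', g', _, _, hf, hg, hf', hg', le_rfl, le_rfl, hT.2, hT', ?_⟩
  apply mul_left_cancel₀ hα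
  linear_combination hdet - f * hg'e + g * hf'e

end Deletion

section Counting

variable [Fintype K]

open Classical in
/-- The points of `K²` lying on no line of `A`. -/
noncomputable def uncovered (A : Finset (Set (K × K))) : Finset (K × K) :=
  Finset.univ.filter fun p => ∀ L ∈ A, p ∉ L

lemma mem_uncovered {A : Finset (Set (K × K))} {p : K × K} :
    p ∈ uncovered A ↔ ∀ L ∈ A, p ∉ L := by
  simp [uncovered]

open Classical in
lemma card_filter_line {L : Set (K × K)} (hL : IsAffineLine L) :
    (Finset.univ.filter fun p => p ∈ L).card = Fintype.card K := by
  obtain ⟨a, b, c, h0, rfl⟩ := hL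
  rw [← Finset.card_univ]
  symm
  rcases ne_or_eq a 0 with ha | rfl
  · refine Finset.card_bij (fun t _ => (-(b * t + c) / a, t)) (fun t _ => ?_) (fun t _ t' _ h => ?_)
      fun p hp => ⟨p.2, Finset.mem_univ _, ?_⟩
    · simp; field_simp; ring
    · simpa using congrArg Prod.snd h
    · simp only [Finset.mem_filter, Finset.mem_univ, true_and, Set.mem_ofPred_eq] at hp
      ext
      · simp only; field_simp; linear_combination -hp
      · rfl
  · have hb : b ≠ 0 := fun hb => h0 (by simp [hb])
    refine Finset.card_bij (fun t _ => (t, -c / b)) (fun t _ => ?_) (fun t _ t' _ h => ?_)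
      fun p hp => ⟨p.1, Finset.mem_univ _, ?_⟩
    · simp; field_simp; ring
    · simpa using congrArg Prod.fst h
    · simp only [Finset.mem_filter, Finset.mem_univ, true_and, Set.mem_ofPred_eq] at hp
      ext
      · rfl
      · simp only; field_simp; linear_combination -hp

/-- Two distinct affine lines meet in at most one point. -/
lemma eq_of_mem_lines {K : Type*} [Field K] {L L' : Set (K × K)} (hL : IsAffineLine L)
    (hL' : IsAffineLine L') (hne : L ≠ L')
    {p p' : K × K} (hp : p ∈ L) (hp' : p ∈ L') (hq : p' ∈ L) (hq' : p' ∈ L') : p = p' := by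
  obtain ⟨a, b, c, h0, rfl⟩ := hL
  obtain ⟨a', b', c', h0', rfl⟩ := hL'
  simp only [Set.mem_ofPred_eq] at hp hp' hq hq'
  have hdet : a * b' - a' * b ≠ 0 := by
    intro hdet
    apply hne
    ext r
    simp only [Set.mem_ofPred_eq]
    rcases ne_or_eq a 0 with ha | rfl
    · have ha' : a' ≠ 0 := by
        rintro rfl
        exact h0' (by simp_all)
      constructor <;> intro h
      · apply mul_left_cancel₀ ha
        linear_combination a' * h - a' * hp + a * hp' + (r.2 - p.2) * hdet
      · apply mul_left_cancel₀ ha'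
        linear_combination a * h + a' * hp - a * hp' - (r.2 - p.2) * hdet
    · have hb : b ≠ 0 := fun hb => h0 (by simp [hb])
      have ha' : a' = 0 := by simpa [hb] using hdet
      subst ha'
      have hb' : b' ≠ 0 := fun hb => h0' (by simp [hb])
      constructor <;> intro h
      · apply mul_left_cancel₀ hb
        linear_combination b' * h - b' * hp + b * hp'
      · apply mul_left_cancel₀ hb'
        linear_combination b * h + b' * hp - b * hp'
  ext
  · apply mul_left_cancel₀ hdet
    linear_combination b' * hp - b * hp' - b' * hq + b * hq'
  · apply mul_left_cancel₀ hdet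
    linear_combination a * hp' - a' * hp - a * hq' + a' * hq

/-- The value at `q` of the characteristic polynomial counts the uncovered points. -/
lemma card_uncovered {A : Finset (Set (K × K))} (hA : IsLineArr A) :
    ((uncovered A).card : ℤ) = (Fintype.card K : ℤ) ^ 2 - A.card * Fintype.card K + b2 A := by
  classical
  let N : Finset (Set (K × K)) → ℤ := fun B =>
    (-1) ^ B.card * ((Finset.univ.filter fun p : K × K => ∀ L ∈ B, p ∈ L).card : ℤ)
  have h1 : ((uncovered A).card : ℤ) = ∑ B ∈ A.powerset, N B := by
    have : ∀ B ∈ A.powerset, N B =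
        ∑ p : K × K, if B ⊆ A.filter (fun L => p ∈ L) then (-1 : ℤ) ^ B.card else 0 := by
      intro B hB
      rw [Finset.mem_powerset] at hB
      simp only [N]
      rw [Finset.card_filter, Nat.cast_sum, Finset.mul_sum]
      refine Finset.sum_congr rfl fun p _ => ?_
      have : (∀ L ∈ B, p ∈ L) ↔ B ⊆ A.filter (fun L => p ∈ L) := by
        simp only [Finset.subset_iff, Finset.mem_filter]
        exact ⟨fun h L hL => ⟨hB hL, h L hL⟩, fun h L hL => (h hL).2⟩
      simp only [this]
      split_ifs <;> simp
    rw [Finset.sum_congr rfl this, Finset.sum_comm, uncovered, Finset.card_filter, Nat.cast_sum]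
    refine Finset.sum_congr rfl fun p _ => ?_
    rw [← Finset.sum_filter]
    have hset : A.powerset.filter (fun B => B ⊆ A.filter (fun L => p ∈ L)) =
        (A.filter (fun L => p ∈ L)).powerset := by
      ext B
      simp only [Finset.mem_filter, Finset.mem_powerset, and_iff_right_iff_imp]
      exact fun h => h.trans (Finset.filter_subset _ _)
    rw [hset, Finset.sum_powerset_neg_one_pow_card]
    simp [Finset.filter_eq_empty_iff]
  have hsmall : ∑ B ∈ A.powerset.filter (fun B => B.card < 2), N B =
      (Fintype.card K : ℤ) ^ 2 - A.card * Fintype.card K := by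
    have hset : A.powerset.filter (fun B => B.card < 2) =
        insert ∅ (A.image fun L => ({L} : Finset (Set (K × K)))) := by
      ext B
      simp only [Finset.mem_filter, Finset.mem_powerset, Finset.mem_insert, Finset.mem_image]
      constructor
      · rintro ⟨hB, hc⟩
        rcases Nat.lt_succ_iff_lt_or_eq.1 hc with hc | hc
        · exact Or.inl (Finset.card_eq_zero.1 (by omega))
        · obtain ⟨L, rfl⟩ := Finset.card_eq_one.1 hc
          exact Or.inr ⟨L, by simpa using hB, rfl⟩
      · rintro (rfl | ⟨L, hL, rfl⟩) <;> simp_all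
    rw [hset, Finset.sum_insert (by simp), Finset.sum_image (by simp)]
    have : ∀ L ∈ A, N {L} = -(Fintype.card K : ℤ) := fun L hL => by
      simp only [N, Finset.mem_singleton, forall_eq, Finset.card_singleton]
      rw [card_filter_line (hA L hL)]
      ring
    rw [Finset.sum_congr rfl this]
    simp [N]
    ring
  have hlarge : ∑ B ∈ A.powerset.filter (fun B => ¬ B.card < 2), N B = b2 A := by
    rw [b2, ← Finset.filter_filter]
    conv_rhs => rw [Finset.sum_filter]
    simp only [not_lt]
    refine Finset.sum_congr rfl fun B hB => ?_
    simp only [Finset.mem_filter, Finset.mem_powerset] at hB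
    obtain ⟨L, hL, L', hL', hne⟩ := Finset.one_lt_card.1 hB.2
    split_ifs with h
    · obtain ⟨p, hp⟩ := h
      simp only [Set.mem_iInter] at hp
      have : (Finset.univ.filter fun p : K × K => ∀ L ∈ B, p ∈ L) = {p} := by
        ext r
        simp only [Finset.mem_filter, Finset.mem_univ, true_and, Finset.mem_singleton]
        refine ⟨fun hr => ?_, fun hr => hr ▸ hp⟩
        exact eq_of_mem_lines (hA L (hB.1 hL)) (hA L' (hB.1 hL')) hne (hr L hL) (hr L' hL')
          (hp L hL) (hp L' hL')
      simp [N, this]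
    · have : (Finset.univ.filter fun p : K × K => ∀ L ∈ B, p ∈ L) = ∅ := by
        refine Finset.filter_eq_empty_iff.2 fun r _ hr => h ⟨r, ?_⟩
        simpa only [Set.mem_iInter] using hr
      simp [N, this]
  rw [h1, ← Finset.sum_filter_add_sum_filter_not _ (fun B => B.card < 2), hsmall, hlarge]

lemma card_le_card_uncovered_add {A : Finset (Set (K × K))} (hA : IsLineArr A) :
    Fintype.card K ^ 2 ≤ (uncovered A).card + A.card * Fintype.card K := by
  classical
  have h : (Finset.univ : Finset (K × K)) ⊆
      uncovered A ∪ A.biUnion fun L => Finset.univ.filter fun p => p ∈ L := by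
    intro p _
    by_cases hp : p ∈ uncovered A
    · exact Finset.mem_union_left _ hp
    · rw [mem_uncovered] at hp
      push Not at hp
      obtain ⟨L, hL, hpL⟩ := hp
      exact Finset.mem_union_right _ (Finset.mem_biUnion.2 ⟨L, hL, by simpa using hpL⟩)
  have h2 := (Finset.card_le_card h).trans (Finset.card_union_le _ _)
  have h3 : (A.biUnion fun L => Finset.univ.filter fun p => p ∈ L).card ≤
      A.card * Fintype.card K :=
    Finset.card_biUnion_le_card_mul _ _ _ fun L hL => (card_filter_line (hA L hL)).le
  rw [Finset.card_univ, Fintype.card_prod, ← pow_two] at h2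
  omega

/-- If `|A|` plus the number of uncovered points is `2 * q - 1`, then every uncovered point lies
on a line, none of whose other points is uncovered. -/
lemma exists_slopeLine {A : Finset (Set (K × K))} (hA : IsLineArr A)
    (hcard : A.card + (uncovered A).card + 1 = 2 * Fintype.card K) {P : K × K}
    (hP : P ∈ uncovered A) :
    ∃ m c : K, P = (P.1, m * P.1 + c) ∧ ∀ t ≠ P.1, ∃ L ∈ A, (t, m * t + c) ∈ L := by
  classical
  have hq : 1 < Fintype.card K := Fintype.one_lt_card
  have hu : (uncovered A).card ≤ Fintype.card K := by
    have := card_le_card_uncovered_add hA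
    by_contra! hlt
    nlinarith
  obtain ⟨m, hm⟩ : ∃ m, m ∉ ((uncovered A).erase P).image
      (fun Q => (Q.2 - P.2) / (Q.1 - P.1)) := by
    by_contra! hall
    have h1 := Finset.card_le_card (fun m _ => hall m : (Finset.univ : Finset K) ⊆ _)
    have h2 := Finset.card_image_le (s := (uncovered A).erase P)
      (f := fun Q => (Q.2 - P.2) / (Q.1 - P.1))
    rw [Finset.card_erase_of_mem hP] at h2
    rw [Finset.card_univ] at h1
    omega
  refine ⟨m, P.2 - m * P.1, by ext <;> simp, fun t ht => ?_⟩
  by_contra! hun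
  refine hm (Finset.mem_image.2 ⟨(t, m * t + (P.2 - m * P.1)), ?_, ?_⟩)
  · refine Finset.mem_erase.2 ⟨fun h => ht (congrArg Prod.fst h), mem_uncovered.2 hun⟩
  · have := sub_ne_zero.2 ht
    simp only
    field_simp
    ring

lemma hasSmallBasis_of_card (u : ℕ) {A : Finset (Set (K × K))} (hA : IsLineArr A)
    (hu : (uncovered A).card = u + 1)
    (hcard : A.card + (uncovered A).card + 1 = 2 * Fintype.card K) : HasSmallBasis A := by
  classical
  induction u generalizing A with
  | zero =>
    obtain ⟨P, hP⟩ := Finset.card_eq_one.1 hu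
    have hPu : P ∈ uncovered A := by simp [hP]
    obtain ⟨m, c, hPe, hcov⟩ := exists_slopeLine hA hcard hPu
    have hPH : P ∈ slopeLine m c := mem_slopeLine.2 (congrArg Prod.snd hPe)
    refine HasSmallBasis.of_insert_covering hA (fun h => mem_uncovered.1 hPu _ h hPH) (by omega)
      (fun p => ?_) hcov (hPe ▸ mem_uncovered.1 hPu)
    by_cases hp : p = P
    · exact ⟨_, Finset.mem_insert_self _ _, hp ▸ hPH⟩
    · have : p ∉ uncovered A := by simpa [hP] using hp
      rw [mem_uncovered] at this
      push Not at this
      obtain ⟨L, hL, hpL⟩ := this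
      exact ⟨L, Finset.mem_insert_of_mem hL, hpL⟩
  | succ u ih =>
    obtain ⟨P, hPu⟩ : (uncovered A).Nonempty := Finset.card_pos.1 (by omega)
    obtain ⟨m, c, hPe, hcov⟩ := exists_slopeLine hA hcard hPu
    have hPH : P ∈ slopeLine m c := mem_slopeLine.2 (congrArg Prod.snd hPe)
    have hH : slopeLine m c ∉ A := fun h => mem_uncovered.1 hPu _ h hPH
    have hun : uncovered (insert (slopeLine m c) A) = (uncovered A).erase P := by
      ext p
      simp only [mem_uncovered, Finset.mem_erase, Finset.forall_mem_insert]
      refine and_congr_left fun hp => ⟨?_, fun hne hpH => ?_⟩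
      · rintro h rfl
        exact h hPH
      · rw [mem_slopeLine] at hpH
        have hne1 : p.1 ≠ P.1 := fun h1 => hne (by
          rw [hPe]
          exact Prod.ext h1 (by rw [hpH, h1]))
        obtain ⟨L, hL, hpL⟩ := hcov p.1 hne1
        exact hp L hL (by rwa [← hpH] at hpL)
    have hun' := congrArg Finset.card hun
    rw [Finset.card_erase_of_mem hPu] at hun'
    refine HasSmallBasis.of_insert hA hH hcov (ih ?_ (by omega) ?_)
    · intro L hL
      rcases Finset.mem_insert.1 hL with rfl | hL
      exacts [isAffineLine_slopeLine m c, hA L hL]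
    · rw [Finset.card_insert_of_notMem hH]
      omega

end Counting

/-- **Theorem 6.3**. Let `A` be an affine line arrangement in `𝔽_q²`. If `χ(A, q−1) = 0`,
then `A` is free. -/
theorem free_of_chi_qsub1_eq_zero
    {K : Type*} [Field K] [Fintype K] (A : Finset (Set (K × K))) (hA : IsLineArr A)
    (h : chi A ((Fintype.card K : ℂ) - 1) = 0) :
    IsFree A := by
  have hq : 1 < Fintype.card K := Fintype.one_lt_card
  have hcard : A.card + (uncovered A).card + 1 = 2 * Fintype.card K := by
    have h1 := card_uncovered hA
    have h2 : ((Fintype.card K : ℤ) - 1) ^ 2 - A.card * ((Fintype.card K : ℤ) - 1) + b2 A = 0 := by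
      rw [chi] at h
      exact_mod_cast h
    zify
    linear_combination h1 + h2
  rcases Nat.eq_zero_or_pos (uncovered A).card with h0 | hpos
  · have hcov : ∀ p : K × K, ∃ L ∈ A, p ∈ L := fun p => by
      by_contra! hp
      have := mem_uncovered.2 hp
      rw [Finset.card_eq_zero.1 h0] at this
      simp at this
    obtain ⟨f, g, hf, hg, hT, hdet⟩ := exists_pair_of_covering hA (d := Fintype.card K - 1)
      (by omega) hcov
    exact isFree_of_det hA hf hg (isHomogeneous_frobForm 0) (isHomogeneous_frobForm 1) hT
      (fun L _ => isTangent_frobForm L) hdet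
  · obtain ⟨f₁, g₁, f₂, g₂, d₁, d₂, hf₁, hg₁, hf₂, hg₂, -, -, hT₁, hT₂, hdet⟩ :=
      hasSmallBasis_of_card ((uncovered A).card - 1) hA (by omega) hcard
    exact isFree_of_det hA hf₁ hg₁ hf₂ hg₂ hT₁ hT₂ hdet
end
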